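/- arXiv:1011.2997 — 3 statements merged into one kernel-verified Lean document; each statement's English description precedes it below -/
import Mathlib

section
/- Let a ∈ I₁ \ F, let f ∈ F, and let M be a nonzero left I₁-module of finite length. Then all four of the K-vector spaces ker(a_M), M/(a·M), ker((a+f)_M), M/((a+f)·M) are finite-dimensional, and dim_K ker((a+f)_M) − dim_K (M/((a+f)·M)) = dim_K ker(a_M) − dim_K (M/(a·M)); that is, the M-index ind_M(c) := dim_K ker(c_M) − dim_K coker(c_M) of a non-compact operator is invariant under addition of an element of F. -/
open Polynomial

noncomputable section
set_option synthInstance.maxHeartbeats 1000000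
set_option maxHeartbeats 1000000
set_option linter.unusedSectionVars false

variable (K : Type*) [Field K] [CharZero K]

/-- The derivative operator `∂ = d/dx` on `K[x]`. -/
def derOp : Module.End K (Polynomial K) := Polynomial.derivative

/-- The multiplication-by-`x` operator on `K[x]`. -/
def xOp : Module.End K (Polynomial K) := LinearMap.mulLeft K Polynomial.X

/-- The integration operator `∫`, determined by `∫ xⁿ = xⁿ⁺¹/(n+1)`. -/
def intOp : Module.End K (Polynomial K) :=
  (Polynomial.basisMonomials K).constr K fun n => ((n : K) + 1)⁻¹ • X ^ (n + 1)

/-- The algebra `I₁` of polynomial integro-differential operators: the subalgebra of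
`End_K(K[x])` generated by `x`, `∂` and `∫`. -/
def I1 : Subalgebra K (Module.End K (Polynomial K)) :=
  Algebra.adjoin K {xOp K, derOp K, intOp K}

/-- `e_{ij} := ∫^i ∂^j − ∫^{i+1} ∂^{j+1}`. -/
def eOp (i j : ℕ) : Module.End K (Polynomial K) :=
  intOp K ^ i * derOp K ^ j - intOp K ^ (i + 1) * derOp K ^ (j + 1)

/-- `F`, the `K`-linear span of the `e_{ij}`; it is the (two-sided) ideal of compact
operators of `I₁`. -/
def Fset : Submodule K (Module.End K (Polynomial K)) :=
  Submodule.span K {f | ∃ i j, f = eOp K i j}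

lemma xOp_mem : xOp K ∈ I1 K := Algebra.subset_adjoin (by simp)
lemma derOp_mem : derOp K ∈ I1 K := Algebra.subset_adjoin (by simp)
lemma intOp_mem : intOp K ∈ I1 K := Algebra.subset_adjoin (by simp)

lemma eOp_mem (i j : ℕ) : eOp K i j ∈ I1 K :=
  sub_mem (mul_mem (pow_mem (intOp_mem K) i) (pow_mem (derOp_mem K) j))
    (mul_mem (pow_mem (intOp_mem K) (i + 1)) (pow_mem (derOp_mem K) (j + 1)))

/-- `e_{ij}` as an element of the ring `I₁`. -/
def eI (i j : ℕ) : I1 K := ⟨eOp K i j, eOp_mem K i j⟩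

/-- `∂` as an element of the ring `I₁`. -/
def derI : I1 K := ⟨derOp K, derOp_mem K⟩

/-- `∫` as an element of the ring `I₁`. -/
def intI : I1 K := ⟨intOp K, intOp_mem K⟩

/-- `H := ∂ ∘ x` (first multiply by `x`, then differentiate). -/
def hOp : Module.End K (Polynomial K) := derOp K * xOp K

/-- `K[H]`, the unital subalgebra of `I₁` generated by `H`. -/
def KH : Subalgebra K (Module.End K (Polynomial K)) := Algebra.adjoin K {hOp K}

/-- The action of `a ∈ I₁` on a left `I₁`-module `M`, as a `K`-linear map `a_M : M → M`. -/
def actMap (a : I1 K) (M : Type*) [AddCommGroup M] [Module (I1 K) M] [Module K M]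
    [SMulCommClass K (I1 K) M] : M →ₗ[K] M where
  toFun m := a • m
  map_add' := smul_add a
  map_smul' k m := (smul_comm k a m).symm

/-- Right multiplication `b ↦ b * a` in a ring `R`, as a homomorphism of left `R`-modules. -/
def rmulMap (R : Type*) [Ring R] (a : R) : R →ₗ[R] R where
  toFun b := b * a
  map_add' b c := add_mul b c a
  map_smul' c b := by simp [smul_eq_mul, mul_assoc]

/-- Left multiplication `b ↦ a * b` in a ring `R`, as a homomorphism of right `R`-modules
(i.e. of left `Rᵐᵒᵖ`-modules). -/
def lmulMap (R : Type*) [Ring R] (a : R) : R →ₗ[Rᵐᵒᵖ] R where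
  toFun b := a * b
  map_add' b c := mul_add a b c
  map_smul' c b := by simp [MulOpposite.smul_eq_mul_unop, mul_assoc]

/-- The centralizer `Cen_{I₁}(a) = {b ∈ I₁ : ab = ba}` of `a` in `I₁`, as a subalgebra of
`End_K(K[x])`. -/
def Cen (a : Module.End K (Polynomial K)) : Subalgebra K (Module.End K (Polynomial K)) :=
  I1 K ⊓ Subalgebra.centralizer K {a}

/-- `Cen_F(a) = {f ∈ F : af = fa}`, a `K`-subspace of `End_K(K[x])`. -/
def CenF (a : Module.End K (Polynomial K)) : Submodule K (Module.End K (Polynomial K)) :=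
  Fset K ⊓ Subalgebra.toSubmodule (Subalgebra.centralizer K {a})


section LinearAlgebra

open Module

variable {𝕜 V W U : Type*} [Field 𝕜] [AddCommGroup V] [Module 𝕜 V] [AddCommGroup W] [Module 𝕜 W]
  [AddCommGroup U] [Module 𝕜 U]

/-- A linear map is Fredholm when its kernel and cokernel are finite-dimensional. -/
structure IsFred (T : V →ₗ[𝕜] W) : Prop where
  ker : FiniteDimensional 𝕜 (LinearMap.ker T)
  coker : FiniteDimensional 𝕜 (W ⧸ LinearMap.range T)

lemma finite_quotient_iff (N : Submodule 𝕜 V) :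
    FiniteDimensional 𝕜 (V ⧸ N) ↔ ∃ C : Submodule 𝕜 V, FiniteDimensional 𝕜 C ∧ N ⊔ C = ⊤ := by
  constructor
  · intro h
    obtain ⟨C, hC⟩ := N.exists_isCompl
    exact ⟨C, Module.Finite.iff_fg.2 (Submodule.CoFG.fg_of_isCompl hC h), hC.sup_eq_top⟩
  · rintro ⟨C, hC, h⟩
    exact Submodule.FG.cofg_of_codisjoint (codisjoint_iff.2 (by rwa [sup_comm]))
      (Module.Finite.iff_fg.1 hC)

lemma finite_of_finite_map_of_finite_ker (T : V →ₗ[𝕜] W) [FiniteDimensional 𝕜 (LinearMap.ker T)]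
    (N : Submodule 𝕜 V) [FiniteDimensional 𝕜 (N.map T)] : FiniteDimensional 𝕜 N :=
  Module.Finite.iff_fg.2 <| Submodule.fg_of_fg_map_of_fg_inf_ker T
    (Module.Finite.iff_fg.1 inferInstance)
    (Module.Finite.iff_fg.1 (Submodule.finiteDimensional_of_le inf_le_right))

namespace IsFred

lemma comp {S : W →ₗ[𝕜] U} {T : V →ₗ[𝕜] W} (hS : IsFred S) (hT : IsFred T) :
    IsFred (S ∘ₗ T) := by
  have := hS.ker
  have := hT.ker
  refine ⟨?_, ?_⟩
  · have : FiniteDimensional 𝕜 ((LinearMap.ker (S ∘ₗ T)).map T) := by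
      refine Submodule.finiteDimensional_of_le (S₂ := LinearMap.ker S) ?_
      rintro _ ⟨v, hv, rfl⟩
      exact hv
    exact finite_of_finite_map_of_finite_ker T _
  · obtain ⟨C, hC, hCt⟩ := (finite_quotient_iff _).1 hS.coker
    obtain ⟨D, hD, hDt⟩ := (finite_quotient_iff _).1 hT.coker
    refine (finite_quotient_iff _).2 ⟨D.map S ⊔ C, inferInstance, ?_⟩
    rw [LinearMap.range_comp, ← sup_assoc, ← Submodule.map_sup, hDt, Submodule.map_top, hCt]

lemma of_comp_left {S : W →ₗ[𝕜] U} {T : V →ₗ[𝕜] W} (h : IsFred (S ∘ₗ T)) (hS : IsFred S) :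
    IsFred T := by
  have := hS.ker
  have := h.ker
  refine ⟨Submodule.finiteDimensional_of_le (LinearMap.ker_le_ker_comp T S), ?_⟩
  obtain ⟨C, hC, hCt⟩ := (finite_quotient_iff _).1 h.coker
  obtain ⟨D, hD⟩ := (LinearMap.range T).exists_isCompl
  refine (finite_quotient_iff _).2 ⟨D, ?_, hD.sup_eq_top⟩
  have h1 : FiniteDimensional 𝕜 (U ⧸ (LinearMap.range T).map S) := by
    rw [← LinearMap.range_comp]; exact h.coker
  let q := ((LinearMap.range T).map S).mkQ ∘ₗ S
  have hk : LinearMap.ker q = LinearMap.range T ⊔ LinearMap.ker S := by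
    simp only [q, LinearMap.ker_comp, Submodule.ker_mkQ, Submodule.comap_map_eq]
  have h2 : FiniteDimensional 𝕜 (W ⧸ LinearMap.ker q) :=
    (LinearMap.quotKerEquivRange q).symm.finiteDimensional
  obtain ⟨E, hE, hEt⟩ := (finite_quotient_iff _).1 h2
  have h3 : FiniteDimensional 𝕜 (W ⧸ LinearMap.range T) := (finite_quotient_iff _).2
    ⟨LinearMap.ker S ⊔ E, inferInstance, by rw [← sup_assoc, ← hk, hEt]⟩
  exact Module.Finite.iff_fg.2 (Submodule.CoFG.fg_of_isCompl hD h3)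

lemma pow {T : V →ₗ[𝕜] V} (hT : IsFred T) (n : ℕ) : IsFred (T ^ n) := by
  induction n with
  | zero =>
    refine ⟨?_, ?_⟩
    · rw [pow_zero, show LinearMap.ker (1 : Module.End 𝕜 V) = ⊥ from LinearMap.ker_id]
      infer_instance
    · rw [pow_zero, show LinearMap.range (1 : Module.End 𝕜 V) = ⊤ from LinearMap.range_id]
      infer_instance
  | succ n ih => rw [pow_succ]; exact ih.comp hT

/-- Being Fredholm is inherited by extensions. -/
lemma of_submodule_quotient {T : V →ₗ[𝕜] V} {N : Submodule 𝕜 V} {TN : N →ₗ[𝕜] N}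
    {TQ : (V ⧸ N) →ₗ[𝕜] (V ⧸ N)} (hN : ∀ n, (TN n : V) = T n)
    (hQ : ∀ v, TQ (N.mkQ v) = N.mkQ (T v)) (h1 : IsFred TN) (h2 : IsFred TQ) : IsFred T := by
  have := h1.ker
  have := h2.ker
  refine ⟨?_, ?_⟩
  · refine Module.Finite.iff_fg.2 (Submodule.fg_of_fg_map_of_fg_inf_ker N.mkQ ?_ ?_)
    · refine Module.Finite.iff_fg.1 (Submodule.finiteDimensional_of_le
        (S₂ := LinearMap.ker TQ) ?_)
      rintro _ ⟨v, hv, rfl⟩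
      rw [LinearMap.mem_ker, hQ, LinearMap.mem_ker.1 hv, map_zero]
    · refine Module.Finite.iff_fg.1 (Submodule.finiteDimensional_of_le
        (S₂ := (LinearMap.ker TN).map N.subtype) ?_)
      rintro v ⟨hv, hv'⟩
      rw [Submodule.ker_mkQ] at hv'
      refine ⟨⟨v, hv'⟩, ?_, rfl⟩
      ext
      rw [hN]
      exact hv
  · obtain ⟨C, hC, hCt⟩ := (finite_quotient_iff _).1 h1.coker
    obtain ⟨D, hD, hDt⟩ := (finite_quotient_iff _).1 h2.coker
    obtain ⟨D', hD', rfl⟩ : ∃ D' : Submodule 𝕜 V, FiniteDimensional 𝕜 D' ∧ D'.map N.mkQ = D := by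
      obtain ⟨g, hg⟩ := N.mkQ.exists_rightInverse_of_surjective N.range_mkQ
      refine ⟨D.map g, inferInstance, ?_⟩
      rw [← Submodule.map_comp, hg, Submodule.map_id]
    refine (finite_quotient_iff _).2 ⟨C.map N.subtype ⊔ D', inferInstance, ?_⟩
    have hle : N ≤ LinearMap.range T ⊔ (C.map N.subtype ⊔ D') := by
      intro n hn
      have : (⟨n, hn⟩ : N) ∈ LinearMap.range TN ⊔ C := hCt ▸ Submodule.mem_top
      obtain ⟨_, ⟨y, rfl⟩, c, hc, h⟩ := Submodule.mem_sup.1 this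
      have h' : T y + c = n := by rw [← hN]; exact congrArg Subtype.val h
      rw [← h']
      exact Submodule.add_mem_sup ⟨y, rfl⟩
        (Submodule.mem_sup_left ⟨c, hc, rfl⟩)
    refine eq_top_iff.2 fun v _ => ?_
    have : N.mkQ v ∈ LinearMap.range TQ ⊔ D'.map N.mkQ := hDt ▸ Submodule.mem_top
    obtain ⟨_, ⟨y, rfl⟩, _, ⟨d, hd, rfl⟩, h⟩ := Submodule.mem_sup.1 this
    obtain ⟨y, rfl⟩ := N.mkQ_surjective y
    rw [hQ, ← map_add, ← sub_eq_zero, ← map_sub, ← LinearMap.mem_ker, Submodule.ker_mkQ] at h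
    have := Submodule.sub_mem _ (Submodule.add_mem_sup (⟨y, rfl⟩ : T y ∈ LinearMap.range T)
      (Submodule.mem_sup_right hd)) (hle h)
    simpa using this

/-- If `U` has finite codimension and meets `ker T` trivially, the index of the Fredholm map `T`
is `codim U - codim T(U)`. -/
lemma index_eq {T : V →ₗ[𝕜] W} (hT : IsFred T) {N : Submodule 𝕜 V}
    (hN : FiniteDimensional 𝕜 (V ⧸ N)) (hd : Disjoint N (LinearMap.ker T)) :
    (finrank 𝕜 (LinearMap.ker T) : ℤ) - finrank 𝕜 (W ⧸ LinearMap.range T) =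
      finrank 𝕜 (V ⧸ N) - finrank 𝕜 (W ⧸ N.map T) := by
  have := hT.ker
  have := hT.coker
  have hTN : FiniteDimensional 𝕜 (W ⧸ N.map T) := by
    obtain ⟨C, hC, hCt⟩ := (finite_quotient_iff _).1 hT.coker
    obtain ⟨D, hD, hDt⟩ := (finite_quotient_iff _).1 hN
    refine (finite_quotient_iff _).2 ⟨D.map T ⊔ C, inferInstance, ?_⟩
    rw [← sup_assoc, ← Submodule.map_sup, hDt, Submodule.map_top, hCt]
  let π : (W ⧸ N.map T) →ₗ[𝕜] (W ⧸ LinearMap.range T) :=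
    Submodule.factor LinearMap.map_le_range
  let φ : (V ⧸ N) →ₗ[𝕜] (W ⧸ N.map T) := N.mapQ (N.map T) T (Submodule.le_comap_map T N)
  let ψ : LinearMap.ker T →ₗ[𝕜] (V ⧸ N) := N.mkQ ∘ₗ (LinearMap.ker T).subtype
  have e1 := LinearMap.finrank_range_add_finrank_ker π
  have e2 := LinearMap.finrank_range_add_finrank_ker φ
  have e3 := LinearMap.finrank_range_add_finrank_ker ψ
  have r1 : LinearMap.range π = ⊤ := LinearMap.range_eq_top.2 (Submodule.factor_surjective _)
  have r2 : LinearMap.ker π = LinearMap.range φ := by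
    ext w
    obtain ⟨w, rfl⟩ := (N.map T).mkQ_surjective w
    constructor
    · intro h
      have h' : w ∈ LinearMap.range T := by
        rw [← (LinearMap.range T).ker_mkQ]; exact h
      obtain ⟨v, rfl⟩ := h'
      exact ⟨N.mkQ v, rfl⟩
    · rintro ⟨v, hv⟩
      obtain ⟨v, rfl⟩ := N.mkQ_surjective v
      rw [← hv, LinearMap.mem_ker]
      exact (Submodule.Quotient.mk_eq_zero _).2 ⟨v, rfl⟩
  have r3 : LinearMap.ker φ = LinearMap.range ψ := by
    ext v
    obtain ⟨v, rfl⟩ := N.mkQ_surjective v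
    constructor
    · intro h
      have h' : T v ∈ N.map T := by
        rw [← (N.map T).ker_mkQ]; exact h
      obtain ⟨n, hn, hnv⟩ := h'
      refine ⟨⟨v - n, by simp [hnv]⟩, ?_⟩
      simp only [ψ, LinearMap.comp_apply, Submodule.subtype_apply, map_sub, sub_eq_self]
      exact (Submodule.Quotient.mk_eq_zero _).2 hn
    · rintro ⟨⟨k, hk⟩, hv⟩
      rw [← hv]
      change Submodule.Quotient.mk (T k) = 0
      rw [LinearMap.mem_ker.1 hk]; rfl
  have r4 : LinearMap.ker ψ = ⊥ := by
    refine LinearMap.ker_eq_bot'.2 fun k hk => Subtype.ext ?_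
    have : (k : V) ∈ N := by rw [← N.ker_mkQ]; exact hk
    exact (Submodule.disjoint_def.1 hd) k this k.2
  rw [r1, finrank_top, r2] at e1
  rw [r3] at e2
  rw [r4, finrank_bot] at e3
  omega

/-- Perturbing a Fredholm map by a finite rank map changes neither Fredholmness nor index. -/
lemma add_finite_range {T S : V →ₗ[𝕜] W} (hT : IsFred T)
    [FiniteDimensional 𝕜 (LinearMap.range S)] : IsFred (T + S) := by
  have := hT.ker
  have hS : FiniteDimensional 𝕜 (V ⧸ LinearMap.ker S) :=
    (LinearMap.quotKerEquivRange S).symm.finiteDimensional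
  refine ⟨?_, ?_⟩
  · have : FiniteDimensional 𝕜 ((LinearMap.ker (T + S)).map S) :=
      Submodule.finiteDimensional_of_le LinearMap.map_le_range
    refine Module.Finite.iff_fg.2 (Submodule.fg_of_fg_map_of_fg_inf_ker S
      (Module.Finite.iff_fg.1 inferInstance) (Module.Finite.iff_fg.1
      (Submodule.finiteDimensional_of_le (S₂ := LinearMap.ker T) ?_)))
    rintro v ⟨hv, hv'⟩
    simpa [LinearMap.mem_ker.1 hv'] using hv
  · obtain ⟨C, hC, hCt⟩ := (finite_quotient_iff _).1 hT.coker
    refine (finite_quotient_iff _).2 ⟨LinearMap.range S ⊔ C, inferInstance, ?_⟩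
    rw [eq_top_iff, ← hCt, ← sup_assoc]
    refine sup_le_sup_right ?_ C
    rintro _ ⟨v, rfl⟩
    have := Submodule.sub_mem (LinearMap.range (T + S) ⊔ LinearMap.range S)
      (Submodule.mem_sup_left (LinearMap.mem_range_self (T + S) v))
      (Submodule.mem_sup_right (LinearMap.mem_range_self S v))
    simpa using this

lemma index_add_finite_range {T S : V →ₗ[𝕜] W} (hT : IsFred T)
    [FiniteDimensional 𝕜 (LinearMap.range S)] :
    (finrank 𝕜 (LinearMap.ker (T + S)) : ℤ) - finrank 𝕜 (W ⧸ LinearMap.range (T + S)) =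
      finrank 𝕜 (LinearMap.ker T) - finrank 𝕜 (W ⧸ LinearMap.range T) := by
  have := hT.ker
  have hS : FiniteDimensional 𝕜 (V ⧸ LinearMap.ker S) :=
    (LinearMap.quotKerEquivRange S).symm.finiteDimensional
  obtain ⟨D, hD⟩ := (LinearMap.ker T).exists_isCompl
  have hDf : FiniteDimensional 𝕜 (V ⧸ D) := (finite_quotient_iff _).2
    ⟨_, this, hD.symm.sup_eq_top⟩
  have hN : FiniteDimensional 𝕜 (V ⧸ (LinearMap.ker S ⊓ D)) := Submodule.CoFG.inf hS hDf
  have hd : Disjoint (LinearMap.ker S ⊓ D) (LinearMap.ker T) :=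
    hD.disjoint.symm.mono_left inf_le_right
  have hd' : Disjoint (LinearMap.ker S ⊓ D) (LinearMap.ker (T + S)) := by
    refine Submodule.disjoint_def.2 fun v hv hv' => Submodule.disjoint_def.1 hd v hv ?_
    simpa [LinearMap.mem_ker.1 hv.1] using hv'
  have hm : (LinearMap.ker S ⊓ D).map (T + S) = (LinearMap.ker S ⊓ D).map T := by
    refine Submodule.ext fun w => ⟨?_, ?_⟩
    · rintro ⟨v, hv, rfl⟩
      exact ⟨v, hv, by simp [LinearMap.mem_ker.1 hv.1]⟩
    · rintro ⟨v, hv, rfl⟩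
      exact ⟨v, hv, by simp [LinearMap.mem_ker.1 hv.1]⟩
  rw [hT.index_eq hN hd, hT.add_finite_range.index_eq hN hd', hm]

end IsFred

lemma finite_iSup_of_finrank_le {A : ℕ → Submodule 𝕜 V} (hA : Monotone A)
    [∀ n, FiniteDimensional 𝕜 (A n)] {B : ℕ} (hB : ∀ n, finrank 𝕜 (A n) ≤ B) :
    FiniteDimensional 𝕜 (⨆ n, A n : Submodule 𝕜 V) := by
  obtain ⟨n, hn⟩ : ∃ n, ∀ m, finrank 𝕜 (A m) ≤ finrank 𝕜 (A n) := by
    have hfin : (Set.range fun n => finrank 𝕜 (A n)).Finite :=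
      (Set.finite_Iic B).subset (by rintro _ ⟨n, rfl⟩; exact hB n)
    obtain ⟨_, ⟨n, rfl⟩, h⟩ := hfin.exists_maximal (Set.range_nonempty _)
    exact ⟨n, fun m => by
      rcases le_total (finrank 𝕜 (A m)) (finrank 𝕜 (A n)) with h' | h'
      · exact h'
      · exact h ⟨m, rfl⟩ h'⟩
  refine Submodule.finiteDimensional_of_le (S₂ := A n) (iSup_le fun m => ?_)
  have := Submodule.eq_of_le_of_finrank_le (hA (le_max_left n m)) (hn _)
  rw [this]
  exact hA (le_max_right n m)

lemma finrank_map_add_finrank_inf_ker (T : V →ₗ[𝕜] W) (N : Submodule 𝕜 V)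
    [FiniteDimensional 𝕜 N] :
    finrank 𝕜 (N.map T) + finrank 𝕜 (N ⊓ LinearMap.ker T : Submodule 𝕜 V) = finrank 𝕜 N := by
  have h := LinearMap.finrank_range_add_finrank_ker (T.domRestrict N)
  have h1 : LinearMap.range (T.domRestrict N) = N.map T := LinearMap.range_domRestrict ..
  have h2 : (LinearMap.ker (T.domRestrict N)).map N.subtype = N ⊓ LinearMap.ker T := by
    ext v
    simp [LinearMap.domRestrict_apply, and_comm]
  rw [← h2, LinearEquiv.finrank_eq (Submodule.equivMapOfInjective N.subtype
    N.injective_subtype _).symm, ← h1, h]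

/-- If an exhausting filtration satisfies `M n ⊆ T (M n) + C`, then `T` is Fredholm. -/
lemma IsFred.of_filtration {T : V →ₗ[𝕜] V} {A : ℕ → Submodule 𝕜 V} (hA : Monotone A)
    [∀ n, FiniteDimensional 𝕜 (A n)] (hAt : ⨆ n, A n = ⊤) (C : Submodule 𝕜 V)
    [FiniteDimensional 𝕜 C] (h : ∀ n, A n ≤ (A n).map T ⊔ C) : IsFred T := by
  refine ⟨?_, (finite_quotient_iff _).2 ⟨C, inferInstance, ?_⟩⟩
  · have hle : LinearMap.ker T ≤ ⨆ n, (A n ⊓ LinearMap.ker T) := by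
      intro v hv
      have : v ∈ ⨆ n, A n := hAt ▸ Submodule.mem_top
      obtain ⟨n, hn⟩ := (Submodule.mem_iSup_of_directed _ hA.directed_le).1 this
      exact Submodule.mem_iSup_of_mem n ⟨hn, hv⟩
    have hfd : ∀ n, FiniteDimensional 𝕜 (A n ⊓ LinearMap.ker T : Submodule 𝕜 V) :=
      fun n => Submodule.finiteDimensional_of_le inf_le_left
    have := finite_iSup_of_finrank_le (A := fun n => A n ⊓ LinearMap.ker T)
      (fun m n hmn => inf_le_inf_right _ (hA hmn)) (B := finrank 𝕜 C) fun n => by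
        have h1 := finrank_map_add_finrank_inf_ker T (A n)
        have h2 := Submodule.finrank_mono (h n)
        have h3 := Submodule.finrank_add_le_finrank_add_finrank ((A n).map T) C
        omega
    exact Submodule.finiteDimensional_of_le hle
  · rw [eq_top_iff, ← hAt]
    exact iSup_le fun n => (h n).trans (sup_le_sup_right LinearMap.map_le_range _)

/-- An endomorphism with finite-dimensional kernel that is compatible with an exhausting
filtration of linear growth is Fredholm. -/
lemma IsFred.of_linear_growth {T : V →ₗ[𝕜] V} {A : ℕ → Submodule 𝕜 V} (hA : Monotone A)
    [∀ n, FiniteDimensional 𝕜 (A n)] (hAt : ⨆ n, A n = ⊤) {c : ℕ}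
    (hc : ∀ n, finrank 𝕜 (A n) ≤ c * (n + 1)) {k : ℕ} (hT : ∀ n, (A n).map T ≤ A (n + k))
    (hker : FiniteDimensional 𝕜 (LinearMap.ker T)) : IsFred T := by
  refine ⟨hker, ?_⟩
  have hjump : ∀ n, ∃ m, n ≤ m ∧ finrank 𝕜 (A (m + k)) ≤ finrank 𝕜 (A m) + c * k := by
    intro n
    by_contra! hcon
    have key : ∀ j, finrank 𝕜 (A n) + j * (c * k + 1) ≤ finrank 𝕜 (A (n + j * k)) := by
      intro j
      induction j with
      | zero => rw [Nat.zero_mul, Nat.zero_mul, Nat.add_zero, Nat.add_zero]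
      | succ j ih =>
        have := hcon (n + j * k) (by omega)
        rw [show n + (j + 1) * k = n + j * k + k by ring]
        linarith
    have h1 := key (c * (n + 1) + 1)
    have h2 := hc (n + (c * (n + 1) + 1) * k)
    nlinarith
  let Q := LinearMap.range T
  have hbd : ∀ n, finrank 𝕜 ((A n).map Q.mkQ) ≤ c * k + finrank 𝕜 (LinearMap.ker T) := by
    intro n
    obtain ⟨m, hnm, hm⟩ := hjump n
    have hle : (A n).map Q.mkQ ≤ (A (m + k)).map Q.mkQ := Submodule.map_mono (hA (by omega))
    have h1 := Submodule.finrank_mono hle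
    have h2 := finrank_map_add_finrank_inf_ker Q.mkQ (A (m + k))
    have h3 := finrank_map_add_finrank_inf_ker T (A m)
    have h4 : (A m).map T ≤ A (m + k) ⊓ LinearMap.ker Q.mkQ := by
      rw [Submodule.ker_mkQ]
      exact le_inf (hT m) LinearMap.map_le_range
    have h5 : FiniteDimensional 𝕜 (A (m + k) ⊓ LinearMap.ker Q.mkQ : Submodule 𝕜 V) :=
      Submodule.finiteDimensional_of_le inf_le_left
    have h6 := Submodule.finrank_mono h4
    have h7 := Submodule.finrank_mono (inf_le_right : A m ⊓ LinearMap.ker T ≤ LinearMap.ker T)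
    omega
  have := finite_iSup_of_finrank_le (A := fun n => (A n).map Q.mkQ)
    (fun m n hmn => Submodule.map_mono (hA hmn)) hbd
  rw [← Submodule.map_iSup, hAt, Submodule.map_top, Submodule.range_mkQ] at this
  exact (Submodule.topEquiv (R := 𝕜) (M := V ⧸ Q)).finiteDimensional

end LinearAlgebra

section SkewPolynomials

open Module

variable {𝕜 R V : Type*} [Field 𝕜] [Ring R] [Algebra 𝕜 R] [AddCommGroup V] [Module 𝕜 V]

lemma mul_aeval_of_mul_eq {d h h' : R} (hd : d * h = h' * d) (p : 𝕜[X]) :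
    d * aeval h p = aeval h' p * d := by
  induction p using Polynomial.induction_on' with
  | add p q hp hq => rw [map_add, map_add, mul_add, add_mul, hp, hq]
  | monomial n c =>
    have : SemiconjBy d (h ^ n) (h' ^ n) := SemiconjBy.pow_right (show SemiconjBy d h h' from hd) n
    rw [aeval_monomial, aeval_monomial, ← mul_assoc, ← Algebra.commutes, mul_assoc, this.eq,
      mul_assoc]

lemma aeval_taylor (h : R) (r : 𝕜) (p : 𝕜[X]) :
    aeval h (taylor r p) = aeval (h + algebraMap 𝕜 R r) p := by
  rw [taylor_apply, aeval_comp]; simp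

lemma mul_aeval {d h : R} (hd : d * h = (h + 1) * d) (p : 𝕜[X]) :
    d * aeval h p = aeval h (taylor 1 p) * d := by
  rw [aeval_taylor, map_one]; exact mul_aeval_of_mul_eq hd p

lemma pow_mul_aeval {d h : R} (hd : d * h = (h + 1) * d) (n : ℕ) (p : 𝕜[X]) :
    d ^ n * aeval h p = aeval h (taylor (n : 𝕜) p) * d ^ n := by
  induction n with
  | zero => simp
  | succ n ih =>
    rw [pow_succ', mul_assoc, ih, ← mul_assoc, mul_aeval hd, taylor_taylor, mul_assoc, ← pow_succ']
    push_cast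
    rw [add_comm]

/-- The value `∑ pᵢ(h) dⁱ` of the skew polynomial with coefficients `pᵢ = D.coeff i`. -/
def evalSkew (h d : R) (D : 𝕜[X][X]) : R := D.eval₂ (aeval h : 𝕜[X] →ₐ[𝕜] R).toRingHom d

lemma evalSkew_eq_sum {n : ℕ} (h d : R) (D : 𝕜[X][X]) (hn : D.natDegree < n) :
    evalSkew h d D = ∑ i ∈ Finset.range n, aeval h (D.coeff i) * d ^ i :=
  eval₂_eq_sum_range' _ hn d

lemma evalSkew_zero (h d : R) : evalSkew h d (0 : 𝕜[X][X]) = 0 := eval₂_zero _ _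

lemma evalSkew_add (h d : R) (D E : 𝕜[X][X]) :
    evalSkew h d (D + E) = evalSkew h d D + evalSkew h d E := eval₂_add _ _

lemma evalSkew_sub (h d : R) (D E : 𝕜[X][X]) :
    evalSkew h d (D - E) = evalSkew h d D - evalSkew h d E := eval₂_sub _

lemma evalSkew_monomial (h d : R) (n : ℕ) (p : 𝕜[X]) :
    evalSkew h d (monomial n p) = aeval h p * d ^ n := eval₂_monomial _ _

lemma evalSkew_C_mul (h d : R) (p : 𝕜[X]) (D : 𝕜[X][X]) :
    evalSkew h d (C p * D) = aeval h p * evalSkew h d D := by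
  induction D using Polynomial.induction_on' with
  | add D E hD hE => rw [mul_add, evalSkew_add, evalSkew_add, hD, hE, mul_add]
  | monomial n q => rw [C_mul_monomial, evalSkew_monomial, evalSkew_monomial, map_mul, mul_assoc]

lemma evalSkew_mul_X_pow (h d : R) (D : 𝕜[X][X]) (n : ℕ) :
    evalSkew h d (D * X ^ n) = evalSkew h d D * d ^ n := by
  induction D using Polynomial.induction_on' with
  | add D E hD hE => rw [add_mul, evalSkew_add, evalSkew_add, hD, hE, add_mul]
  | monomial m q =>
    rw [monomial_mul_X_pow, evalSkew_monomial, evalSkew_monomial, pow_add, mul_assoc]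

lemma mul_evalSkew {h d : R} (hd : d * h = (h + 1) * d) (D : 𝕜[X][X]) :
    d * evalSkew h d D =
      evalSkew h d (D.map (taylorAlgHom (1 : 𝕜) : 𝕜[X] →ₐ[𝕜] 𝕜[X]).toRingHom * X) := by
  induction D using Polynomial.induction_on' with
  | add D E hD hE => rw [Polynomial.map_add, add_mul, evalSkew_add, evalSkew_add, mul_add, hD, hE]
  | monomial m q =>
    rw [map_monomial, monomial_mul_X, evalSkew_monomial, evalSkew_monomial, ← mul_assoc,
      mul_aeval hd, mul_assoc, ← pow_succ']
    rfl

lemma map_evalSkew {R' : Type*} [Ring R'] [Algebra 𝕜 R'] (φ : R →ₐ[𝕜] R') (h d : R)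
    (D : 𝕜[X][X]) : φ (evalSkew h d D) = evalSkew (φ h) (φ d) D := by
  induction D using Polynomial.induction_on' with
  | add D E hD hE => rw [evalSkew_add, evalSkew_add, map_add, hD, hE]
  | monomial m q =>
    rw [evalSkew_monomial, evalSkew_monomial, map_mul, map_pow, aeval_algHom_apply]

lemma exists_eq_mul_X_pow {A : Type*} [CommRing A] [IsDomain A] {D : A[X]} (hD : D ≠ 0) :
    ∃ (E : A[X]) (n : ℕ), E.coeff 0 ≠ 0 ∧ D = E * X ^ n := by
  obtain ⟨E, hE, hdvd⟩ := exists_eq_pow_rootMultiplicity_mul_and_not_dvd D hD 0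
  rw [C_0, sub_zero] at hE hdvd
  exact ⟨E, _, fun h => hdvd (X_dvd_iff.2 h), by rw [mul_comm]; exact hE⟩

lemma taylor_ne_zero (r : 𝕜) {p : 𝕜[X]} (hp : p ≠ 0) : taylor r p ≠ 0 :=
  fun h => hp (taylor_injective r (by rw [h, map_zero]))

/-- Two nonzero polynomials become coprime after almost all integer shifts. -/
lemma exists_isCoprime_taylor [CharZero 𝕜] {p q : 𝕜[X]} (hp : p ≠ 0) (hq : q ≠ 0) :
    ∃ N : ℕ, ∀ i : ℤ, N < i.natAbs → IsCoprime q (taylor (i : 𝕜) p) := by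
  let L := AlgebraicClosure 𝕜
  have : CharZero L := charZero_of_injective_algebraMap (algebraMap 𝕜 L).injective
  have hfin : {i : ℤ | ¬ IsCoprime q (taylor (i : 𝕜) p)}.Finite := by
    refine Set.Finite.subset (Set.Finite.preimage (Int.cast_injective (α := L)).injOn
      ((p.rootSet_finite L).image2 (fun a b => a - b) (q.rootSet_finite L))) ?_
    intro i hi
    rw [Set.mem_ofPred_eq, isCoprime_iff_aeval_ne_zero_of_isAlgClosed 𝕜 L] at hi
    push Not at hi
    obtain ⟨a, ha, ha'⟩ := hi
    rw [aeval_taylor] at ha'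
    exact ⟨_, (mem_rootSet_of_ne hp).2 ha', a, (mem_rootSet_of_ne hq).2 ha, by simp⟩
  obtain ⟨N, hN⟩ := (hfin.image Int.natAbs).bddAbove
  refine ⟨N, fun i hi => ?_⟩
  by_contra h
  exact absurd (hN ⟨i, h, rfl⟩) (by omega)

/-- The map `p ↦ p(h) v`. -/
def polyAct (h : Module.End 𝕜 V) (v : V) : 𝕜[X] →ₗ[𝕜] V :=
  LinearMap.applyₗ v ∘ₗ (aeval h : 𝕜[X] →ₐ[𝕜] Module.End 𝕜 V).toLinearMap

lemma polyAct_apply (h : Module.End 𝕜 V) (v : V) (p : 𝕜[X]) :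
    polyAct h v p = aeval h p v := rfl

/-- The span of `v, h v, …, hᴶ⁻¹ v`. -/
def polySpan (h : Module.End 𝕜 V) (J : ℕ) (v : V) : Submodule 𝕜 V :=
  (degreeLT 𝕜 J).map (polyAct h v)

instance finiteDimensional_degreeLT (J : ℕ) : FiniteDimensional 𝕜 (degreeLT 𝕜 J) :=
  (degreeLTEquiv 𝕜 J).symm.finiteDimensional

lemma finrank_degreeLT (J : ℕ) : finrank 𝕜 (degreeLT 𝕜 J) = J := by
  rw [(degreeLTEquiv 𝕜 J).finrank_eq, finrank_fin_fun]

instance (h : Module.End 𝕜 V) (J : ℕ) (v : V) : FiniteDimensional 𝕜 (polySpan h J v) := by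
  unfold polySpan; infer_instance

lemma finrank_polySpan_le (h : Module.End 𝕜 V) (J : ℕ) (v : V) :
    finrank 𝕜 (polySpan h J v) ≤ J :=
  (Submodule.finrank_map_le _ _).trans (finrank_degreeLT J).le

lemma aeval_apply_mem_polySpan (h : Module.End 𝕜 V) {J : ℕ} (v : V) {p : 𝕜[X]}
    (hp : p.degree < J) : aeval h p v ∈ polySpan h J v :=
  ⟨p, mem_degreeLT.2 hp, rfl⟩

lemma polySpan_mono (h : Module.End 𝕜 V) {I J : ℕ} (hIJ : I ≤ J) (v : V) :
    polySpan h I v ≤ polySpan h J v :=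
  Submodule.map_mono (degreeLT_mono hIJ)

lemma range_polyAct_le {h : Module.End 𝕜 V} {v : V} {q : 𝕜[X]} (hq : q ≠ 0)
    (hqv : aeval h q v = 0) : LinearMap.range (polyAct h v) ≤ polySpan h q.natDegree v := by
  rintro _ ⟨p, rfl⟩
  have e : aeval h p v = aeval h (p % q) v := by
    conv_lhs => rw [← EuclideanDomain.mod_add_div p q, mul_comm q]
    rw [map_add, map_mul, LinearMap.add_apply, Module.End.mul_apply, hqv, map_zero, add_zero]
  rw [polyAct_apply, e]
  refine aeval_apply_mem_polySpan _ _ ?_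
  rw [← degree_eq_natDegree hq]
  exact EuclideanDomain.mod_lt p hq

variable {h δ : Module.End 𝕜 V} {g : ℤ → V}

lemma pow_apply_family (hg : ∀ i, δ (g i) = g (i + 1)) (k : ℕ) (i : ℤ) :
    (δ ^ k) (g i) = g (i + k) := by
  induction k with
  | zero => simp
  | succ k ih => rw [pow_succ', Module.End.mul_apply, ih, hg]; push_cast; rw [add_assoc]

lemma evalSkew_apply_family (hδ : δ * h = (h + 1) * δ) (hg : ∀ i, δ (g i) = g (i + 1))
    (D : 𝕜[X][X]) (p : 𝕜[X]) (i : ℤ) {n : ℕ} (hn : D.natDegree < n) :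
    evalSkew h δ D (aeval h p (g i)) =
      ∑ k ∈ Finset.range n, aeval h (D.coeff k * taylor (k : 𝕜) p) (g (i + k)) := by
  rw [evalSkew_eq_sum h δ D hn, LinearMap.sum_apply]
  refine Finset.sum_congr rfl fun k _ => ?_
  rw [← Module.End.mul_apply, mul_assoc, pow_mul_aeval hδ, Module.End.mul_apply,
    Module.End.mul_apply, pow_apply_family hg, map_mul, Module.End.mul_apply]

/-- The torsion case: if `V` is spanned by the spaces `𝕜[h] gᵢ`, each killed by a shift of a fixed
polynomial, then every skew polynomial with nonzero constant term acts as a Fredholm map. -/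
lemma isFred_evalSkew_of_torsion [CharZero 𝕜] (hδ : δ * h = (h + 1) * δ)
    (hg : ∀ i, δ (g i) = g (i + 1)) {p : 𝕜[X]} (hp : p ≠ 0)
    (hpg : ∀ i : ℤ, aeval h (taylor (i : 𝕜) p) (g i) = 0)
    (htop : ⨆ i, LinearMap.range (polyAct h (g i)) = ⊤) {D : 𝕜[X][X]} (hD : D.coeff 0 ≠ 0) :
    IsFred (evalSkew h δ D) := by
  set r := D.natDegree with hr
  have hD0 : D ≠ 0 := by rintro rfl; simp at hD
  have hlead : D.coeff r ≠ 0 := leadingCoeff_ne_zero.2 hD0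
  obtain ⟨N₀, hN₀⟩ := exists_isCoprime_taylor hp hD
  obtain ⟨N₁, hN₁⟩ := exists_isCoprime_taylor hp hlead
  set P : ℤ → Submodule 𝕜 V := fun i => LinearMap.range (polyAct h (g i)) with hP
  have hPfin : ∀ i, FiniteDimensional 𝕜 (P i) := fun i =>
    Submodule.finiteDimensional_of_le (range_polyAct_le (taylor_ne_zero _ hp) (hpg i))
  have hmem : ∀ i (q : 𝕜[X]), aeval h q (g i) ∈ P i := fun i q => ⟨q, rfl⟩
  set B : ℤ → ℤ → Submodule 𝕜 V := fun a b => (Finset.Icc a b).sup P with hB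
  have hPB : ∀ {i a b}, a ≤ i → i ≤ b → P i ≤ B a b := fun h1 h2 =>
    Finset.le_sup (f := P) (Finset.mem_Icc.2 ⟨h1, h2⟩)
  have hBle : ∀ {a b} {S : Submodule 𝕜 V}, (∀ i, a ≤ i → i ≤ b → P i ≤ S) → B a b ≤ S :=
    fun h => Finset.sup_le fun i hi => h i (Finset.mem_Icc.1 hi).1 (Finset.mem_Icc.1 hi).2
  have hBfin : ∀ a b, FiniteDimensional 𝕜 (B a b) := fun a b =>
    Submodule.finiteDimensional_finset_sup _ _
  have hdiv : ∀ {c : 𝕜[X]} {j : ℤ}, IsCoprime c (taylor (j : 𝕜) p) →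
      ∀ q : 𝕜[X], ∃ q', aeval h q (g j) = aeval h (c * q') (g j) := by
    rintro c j ⟨u, v, huv⟩ q
    refine ⟨u * q, ?_⟩
    have : q = c * (u * q) + q * v * taylor (j : 𝕜) p := by
      linear_combination (-q) * huv
    conv_lhs => rw [this]
    rw [map_add, LinearMap.add_apply, map_mul _ (q * v), Module.End.mul_apply, hpg, map_zero,
      add_zero]
  set T := evalSkew h δ D with hT
  have hTP : ∀ i (q : 𝕜[X]), T (aeval h q (g i)) ∈ (P i).map T := fun i q => ⟨_, hmem i q, rfl⟩
  have up : ∀ i : ℤ, N₁ < (i + r).natAbs → P (i + r) ≤ (P i).map T ⊔ B i (i + r - 1) := by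
    rintro i hi _ ⟨q, rfl⟩
    obtain ⟨q', hq'⟩ := hdiv (hN₁ _ hi) q
    have e := evalSkew_apply_family hδ hg D (taylor (-r : 𝕜) q') i (Nat.lt_succ_self r)
    rw [Finset.sum_range_succ, taylor_taylor, add_neg_cancel, taylor_zero, ← hq',
      ← sub_eq_iff_eq_add'] at e
    rw [polyAct_apply, ← e]
    refine Submodule.sub_mem _ (Submodule.mem_sup_left (hTP _ _)) (Submodule.mem_sup_right ?_)
    refine Submodule.sum_mem _ fun k hk => hPB ?_ ?_ (hmem _ _)
    · omega
    · have := Finset.mem_range.1 hk; omega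
  have down : ∀ i : ℤ, N₀ < i.natAbs → P i ≤ (P i).map T ⊔ B (i + 1) (i + r) := by
    rintro i hi _ ⟨q, rfl⟩
    obtain ⟨q', hq'⟩ := hdiv (hN₀ _ hi) q
    have e := evalSkew_apply_family hδ hg D q' i (Nat.lt_succ_self r)
    rw [Finset.sum_range_succ', Nat.cast_zero, taylor_zero, Nat.cast_zero, add_zero, ← hq',
      ← sub_eq_iff_eq_add'] at e
    rw [polyAct_apply, ← e]
    refine Submodule.sub_mem _ (Submodule.mem_sup_left (hTP _ _)) (Submodule.mem_sup_right ?_)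
    refine Submodule.sum_mem _ fun k hk => hPB ?_ ?_ (hmem _ _)
    · omega
    · have := Finset.mem_range.1 hk; omega
  set N := N₀ + N₁ with hN
  set C := B (-N) (N + r) with hC
  have main : ∀ n : ℕ, B (-(N + n)) (N + n + r) ≤ (B (-(N + n)) (N + n)).map T ⊔ C := by
    intro n
    induction n with
    | zero => simp only [Nat.cast_zero, add_zero]; exact le_sup_right
    | succ n ih =>
      have hmono : (B (-(N + n)) (N + n)).map T ⊔ C ≤
          (B (-(N + (n + 1 : ℕ))) (N + (n + 1 : ℕ))).map T ⊔ C :=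
        sup_le_sup_right (Submodule.map_mono (hBle fun i h1 h2 => hPB (by omega) (by omega))) _
      have ih' := ih.trans hmono
      refine hBle fun i h1 h2 => ?_
      rcases lt_or_ge i (-(N + n)) with h3 | h3
      · obtain rfl : i = -(N + (n + 1 : ℕ)) := by omega
        refine (down _ (by omega)).trans (sup_le (le_sup_of_le_left (Submodule.map_mono
          (hPB (by omega) (by omega)))) (le_trans (hBle fun j h4 h5 => ?_) ih'))
        exact hPB (by omega) (by omega)
      · rcases le_or_gt i (N + n + r) with h4 | h4
        · exact (hPB h3 h4).trans ih'
        · obtain ⟨j, rfl, rfl⟩ : ∃ j : ℤ, i = j + r ∧ j = N + (n + 1 : ℕ) :=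
            ⟨N + (n + 1 : ℕ), by omega, rfl⟩
          refine (up _ (by omega)).trans (sup_le (le_sup_of_le_left (Submodule.map_mono
            (hPB (by omega) (by omega)))) (le_trans (hBle fun j h4 h5 => ?_) ih'))
          exact hPB (by omega) (by omega)
  refine IsFred.of_filtration (A := fun n : ℕ => B (-(N + n)) (N + n)) ?_ ?_ C fun n =>
    le_trans (hBle fun i h1 h2 => hPB h1 (by omega)) (main n)
  · exact fun m n hmn => hBle fun i h1 h2 => hPB (by omega) (by omega)
  · rw [eq_top_iff, ← htop]
    exact iSup_le fun i => le_iSup_of_le i.natAbs (hPB (by omega) (by omega))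

/-- The sum of the spaces `polySpan h J (g i)` over `a ≤ i < a + l`. -/
def boxSpan (h : Module.End 𝕜 V) (g : ℤ → V) (a : ℤ) (l J : ℕ) : Submodule 𝕜 V :=
  (Finset.range l).sup fun k => polySpan h J (g (a + k))

instance (a : ℤ) (l J : ℕ) : FiniteDimensional 𝕜 (boxSpan h g a l J) :=
  Submodule.finiteDimensional_finset_sup _ _

lemma polySpan_le_boxSpan {a i : ℤ} {l I J : ℕ} (h1 : a ≤ i) (h2 : i < a + l) (hIJ : I ≤ J) :
    polySpan h I (g i) ≤ boxSpan h g a l J := by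
  obtain ⟨k, rfl⟩ := Int.le.dest h1
  exact (polySpan_mono h hIJ _).trans (Finset.le_sup (f := fun k : ℕ => polySpan h J (g (a + k)))
    (Finset.mem_range.2 (by omega)))

lemma boxSpan_le {a : ℤ} {l J : ℕ} {S : Submodule 𝕜 V}
    (hS : ∀ i, a ≤ i → i < a + l → polySpan h J (g i) ≤ S) : boxSpan h g a l J ≤ S :=
  Finset.sup_le fun k hk => hS _ (by omega) (by have := Finset.mem_range.1 hk; omega)

lemma finrank_boxSpan_le (a : ℤ) (l J : ℕ) : finrank 𝕜 (boxSpan h g a l J) ≤ l * J := by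
  induction l with
  | zero => rw [boxSpan, Finset.range_zero, Finset.sup_empty, finrank_bot]; exact Nat.zero_le _
  | succ l ih =>
    have : boxSpan h g a (l + 1) J = polySpan h J (g (a + l)) ⊔ boxSpan h g a l J := by
      unfold boxSpan; rw [Finset.range_add_one, Finset.sup_insert]
    rw [this]
    have h1 := Submodule.finrank_add_le_finrank_add_finrank (polySpan h J (g (a + l)))
      (boxSpan h g a l J)
    have h2 := finrank_polySpan_le h J (g (a + l))
    rw [Nat.succ_mul]
    omega

lemma degree_mul_lt_add {p q : 𝕜[X]} {m n : ℕ} (hp : p.degree < m) (hq : q.degree ≤ n) :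
    (q * p).degree < (m + n : ℕ) := by
  rcases eq_or_ne p 0 with rfl | hp0
  · simp
  rw [degree_lt_iff_coeff_zero]
  intro k hk
  have h1 := (natDegree_lt_iff_degree_lt hp0).2 hp
  have h2 := natDegree_le_of_degree_le hq
  have h3 := natDegree_mul_le (p := q) (q := p)
  exact coeff_eq_zero_of_natDegree_lt (by omega)

lemma natDegree_le_of_degree_lt_succ {p : 𝕜[X]} {n : ℕ} (hp : p.degree < (n + 1 : ℕ)) :
    p.natDegree ≤ n := by
  rcases eq_or_ne p 0 with rfl | hp0
  · simp
  · exact Nat.lt_succ_iff.1 ((natDegree_lt_iff_degree_lt hp0).2 hp)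

lemma aeval_apply_comm (h : Module.End 𝕜 V) (p q : 𝕜[X]) (v : V) :
    aeval h p (aeval h q v) = aeval h q (aeval h p v) := by
  rw [← Module.End.mul_apply, ← Module.End.mul_apply, ← map_mul, ← map_mul, mul_comm]

/-- A linear relation among the `gᵢ` with leading coefficients of bounded degree makes the boxes
grow linearly. -/
lemma finrank_boxSpan_le_of_relation {d : 𝕜[X][X]} (hd : d ≠ 0) {Δ : ℕ}
    (hΔ : ∀ k, (d.coeff k).natDegree ≤ Δ)
    (hrel : ∀ i : ℤ, ∑ k ∈ Finset.range (d.natDegree + 1),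
      aeval h (taylor (i : 𝕜) (d.coeff k)) (g (i + k)) = 0) (a : ℤ) (l J : ℕ) :
    finrank 𝕜 (boxSpan h g a (d.natDegree + l) J) ≤ l * Δ + d.natDegree * (J + l * Δ) := by
  induction l generalizing J with
  | zero => simpa using finrank_boxSpan_le (h := h) (g := g) a d.natDegree J
  | succ l ih =>
    set r := d.natDegree with hr
    have hle : boxSpan h g a (r + (l + 1)) J ≤
        polySpan h Δ (g (a + l + r)) ⊔ boxSpan h g a (r + l) (J + Δ) := by
      refine boxSpan_le fun i h1 h2 => ?_
      rcases lt_or_ge i (a + l + r) with h3 | h3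
      · exact le_sup_of_le_right (polySpan_le_boxSpan h1 (by push_cast; omega) (by omega))
      obtain rfl : i = a + l + r := by push_cast at h2; omega
      rintro _ ⟨p, hp, rfl⟩
      have hp' : p.degree < J := mem_degreeLT.1 hp
      set q := taylor ((a + l : ℤ) : 𝕜) (d.coeff r) with hq
      have hq0 : q ≠ 0 := taylor_ne_zero _ (leadingCoeff_ne_zero.2 hd)
      have hdegq : ∀ k, (taylor ((a + l : ℤ) : 𝕜) (d.coeff k)).degree ≤ Δ := fun k =>
        degree_le_of_natDegree_le (by rw [natDegree_taylor]; exact hΔ k)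
      have e := hrel (a + l)
      rw [Finset.sum_range_succ, add_eq_zero_iff_neg_eq] at e
      rw [polyAct_apply, ← EuclideanDomain.mod_add_div p q, mul_comm q, map_add,
        LinearMap.add_apply, map_mul, Module.End.mul_apply, ← e]
      refine Submodule.add_mem_sup (aeval_apply_mem_polySpan _ _
        ((EuclideanDomain.mod_lt p hq0).trans_le (hdegq r))) ?_
      rw [map_neg, map_sum]
      refine Submodule.neg_mem _ (Submodule.sum_mem _ fun k hk => ?_)
      have hk' := Finset.mem_range.1 hk
      refine polySpan_le_boxSpan (i := a + l + k) (by omega) (by push_cast; omega) le_rfl ?_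
      rw [← Module.End.mul_apply, ← map_mul]
      refine aeval_apply_mem_polySpan _ _ ?_
      rw [mul_comm]
      exact degree_mul_lt_add ((degree_div_le p q).trans_lt hp') (hdegq k)
    have h1 := Submodule.finrank_mono hle
    have h2 := Submodule.finrank_add_le_finrank_add_finrank (polySpan h Δ (g (a + l + r)))
      (boxSpan h g a (r + l) (J + Δ))
    have h3 := finrank_polySpan_le h Δ (g (a + l + r))
    have h4 := ih (J + Δ)
    rw [show J + (l + 1) * Δ = J + Δ + l * Δ by ring, Nat.succ_mul]
    omega

lemma exists_natDegree_coeff_le (D : 𝕜[X][X]) : ∃ Δ : ℕ, ∀ k, (D.coeff k).natDegree ≤ Δ := by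
  refine ⟨D.support.sup fun k => (D.coeff k).natDegree, fun k => ?_⟩
  by_cases hk : k ∈ D.support
  · exact Finset.le_sup (f := fun k => (D.coeff k).natDegree) hk
  · simp [notMem_support_iff.1 hk]

lemma natDegree_eq_zero_of_taylor_eq [CharZero 𝕜] {p : 𝕜[X]} (hp : taylor 1 p = p) :
    p.natDegree = 0 := by
  have h1 : ∀ n : ℕ, p.eval (n : 𝕜) = p.eval 0 := by
    intro n
    induction n with
    | zero => simp
    | succ n ih => rw [← ih]; conv_rhs => rw [← hp, taylor_eval]
                   push_cast; rfl
  have h2 : p = C (p.eval 0) := by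
    refine eq_of_infinite_eval_eq _ _ (Set.Infinite.mono ?_
      (Set.infinite_range_of_injective (Nat.cast_injective (R := 𝕜))))
    rintro _ ⟨n, rfl⟩
    simpa using h1 n
  rw [h2, natDegree_C]

lemma natDegree_taylor_sub_le {p : 𝕜[X]} {N : ℕ} (hp : p.natDegree ≤ N + 1) :
    (taylor 1 p - p).natDegree ≤ N := by
  rcases Nat.eq_zero_or_pos p.natDegree with h0 | h0
  · rw [eq_C_of_natDegree_eq_zero h0, taylor_C, sub_self, natDegree_zero]
    exact Nat.zero_le N
  · have hp0 : p ≠ 0 := by rintro rfl; simp at h0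
    have hlt : (taylor 1 p - p).degree < p.degree :=
      (degree_sub_lt_left (degree_taylor p 1) (taylor_ne_zero 1 hp0)
        (leadingCoeff_taylor 1 p)).trans_eq (degree_taylor p 1)
    rcases eq_or_ne (taylor 1 p - p) 0 with h1 | h1
    · rw [h1, natDegree_zero]; exact Nat.zero_le N
    · have := natDegree_lt_natDegree h1 hlt
      omega

/-- Casoratian argument: solutions of a skew polynomial equation that are linearly independent
over `𝕜` satisfy no simultaneous polynomial relation. -/
lemma relation_eq_zero [CharZero 𝕜] (hδ : δ * h = (h + 1) * δ) {D : 𝕜[X][X]}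
    (hinj : ∀ v, aeval h (D.coeff 0) v = 0 → v = 0) {ι : Type*} [Fintype ι] {u : ι → V}
    (hu : LinearIndependent 𝕜 u) (hDu : ∀ j, evalSkew h δ D (u j) = 0) (N : ℕ) (c : ι → 𝕜[X])
    (hN : ∀ j, (c j).natDegree ≤ N)
    (hc : ∀ i < D.natDegree + 1, ∑ j, aeval h (c j) ((δ ^ i) (u j)) = 0) : c = 0 := by
  have const : ∀ c : ι → 𝕜[X], (∀ j, (c j).natDegree = 0) →
      (∀ i < D.natDegree + 1, ∑ j, aeval h (c j) ((δ ^ i) (u j)) = 0) → c = 0 := by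
    intro c hN hc
    have h0 := hc 0 (Nat.succ_pos _)
    have h1 : ∑ j, (c j).coeff 0 • u j = 0 := by
      rw [← h0]
      refine Finset.sum_congr rfl fun j _ => ?_
      conv_rhs => rw [eq_C_of_natDegree_eq_zero (hN j)]
      simp [aeval_C, Module.algebraMap_end_apply]
    have h2 := Fintype.linearIndependent_iff.1 hu _ h1
    funext j
    rw [eq_C_of_natDegree_eq_zero (hN j), h2 j, C_0, Pi.zero_apply]
  induction N generalizing c with
  | zero => exact const c (fun j => Nat.le_zero.1 (hN j)) hc
  | succ N ih =>
    have hshift : ∀ k < D.natDegree,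
        ∑ j, aeval h (taylor 1 (c j)) ((δ ^ (k + 1)) (u j)) = 0 := by
      intro k hk
      have := congrArg δ (hc k (by omega))
      rw [map_sum, map_zero] at this
      rw [← this]
      refine Finset.sum_congr rfl fun j _ => ?_
      rw [← Module.End.mul_apply δ, mul_aeval hδ, Module.End.mul_apply, pow_succ',
        Module.End.mul_apply]
    have hzero : ∑ j, aeval h (taylor 1 (c j)) (u j) = 0 := by
      apply hinj
      have e : ∑ j, aeval h (taylor 1 (c j)) (evalSkew h δ D (u j)) = 0 := by simp [hDu]
      simp only [evalSkew_eq_sum h δ D (Nat.lt_succ_self _), LinearMap.sum_apply, map_sum] at e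
      rw [Finset.sum_comm, Finset.sum_range_succ', Finset.sum_eq_zero, zero_add] at e
      · rw [← e, map_sum]
        refine Finset.sum_congr rfl fun j _ => ?_
        rw [pow_zero, mul_one, aeval_apply_comm]
      · intro k hk
        have := congrArg (aeval h (D.coeff (k + 1))) (hshift k (Finset.mem_range.1 hk))
        rw [map_sum, map_zero] at this
        rw [← this]
        refine Finset.sum_congr rfl fun j _ => ?_
        rw [Module.End.mul_apply, aeval_apply_comm]
    have hdiff : (fun j => taylor 1 (c j) - c j) = 0 := by
      refine ih _ (fun j => natDegree_taylor_sub_le (hN j)) fun i hi => ?_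
      simp only [map_sub, LinearMap.sub_apply, Finset.sum_sub_distrib]
      rw [hc i hi, sub_zero]
      cases i with
      | zero => simpa using hzero
      | succ k => exact hshift k (by omega)
    exact const c (fun j => natDegree_eq_zero_of_taylor_eq (sub_eq_zero.1 (congrFun hdiff j))) hc

lemma aeval_mem_of_map_le {A : ℕ → Submodule 𝕜 V} (hA : Monotone A)
    (hh : ∀ n, (A n).map h ≤ A (n + 1)) {n k : ℕ} {v : V} (hv : v ∈ A n) {p : 𝕜[X]}
    (hp : p.natDegree ≤ k) : aeval h p v ∈ A (n + k) := by
  have hpow : ∀ i, (h ^ i) v ∈ A (n + i) := by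
    intro i
    induction i with
    | zero => simpa using hv
    | succ i ih => rw [pow_succ', Module.End.mul_apply]; exact hh _ ⟨_, ih, rfl⟩
  rw [aeval_eq_sum_range, LinearMap.sum_apply]
  refine Submodule.sum_mem _ fun i hi => Submodule.smul_mem _ _ (hA ?_ (hpow i))
  have := Finset.mem_range.1 hi
  omega

/-- In the torsion-free case, linear growth forces kernels to be finite-dimensional. -/
lemma finite_ker_evalSkew [CharZero 𝕜] (hδ : δ * h = (h + 1) * δ) {D : 𝕜[X][X]}
    (hinj : ∀ v, aeval h (D.coeff 0) v = 0 → v = 0) {A : ℕ → Submodule 𝕜 V} (hA : Monotone A)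
    [∀ n, FiniteDimensional 𝕜 (A n)] (hAt : ⨆ n, A n = ⊤) {c : ℕ}
    (hc : ∀ n, finrank 𝕜 (A n) ≤ c * (n + 1)) (hh : ∀ n, (A n).map h ≤ A (n + 1)) :
    FiniteDimensional 𝕜 (LinearMap.ker (evalSkew h δ D)) := by
  set r := D.natDegree + 1 with hr
  have hrank : Module.rank 𝕜 (LinearMap.ker (evalSkew h δ D)) ≤ (r * c : ℕ) := by
    refine rank_le fun s hs => ?_
    by_contra! hlt
    let u : s → V := fun j => ((j : LinearMap.ker (evalSkew h δ D)) : V)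
    have hu : LinearIndependent 𝕜 u := hs.map' _ (Submodule.ker_subtype _)
    obtain ⟨n₀, hn₀⟩ : ∃ n₀, ∀ (i : Fin r) (j : s), (δ ^ (i : ℕ)) (u j) ∈ A n₀ := by
      have hex : ∀ x : Fin r × s, ∃ n, (δ ^ (x.1 : ℕ)) (u x.2) ∈ A n := fun x =>
        (Submodule.mem_iSup_of_directed _ hA.directed_le).1 (hAt ▸ Submodule.mem_top)
      choose f hf using hex
      exact ⟨Finset.univ.sup f, fun i j =>
        hA (Finset.le_sup (f := f) (Finset.mem_univ (i, j))) (hf (i, j))⟩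
    let n := r * c * n₀
    have hmem : ∀ (i : Fin r) (p : s → degreeLT 𝕜 (n + 1)),
        (∑ j, (polyAct h ((δ ^ (i : ℕ)) (u j)) ∘ₗ (degreeLT 𝕜 (n + 1)).subtype ∘ₗ
          LinearMap.proj j) : (s → degreeLT 𝕜 (n + 1)) →ₗ[𝕜] V) p ∈ A (n₀ + n) := by
      intro i p
      rw [LinearMap.sum_apply]
      refine Submodule.sum_mem _ fun j _ => aeval_mem_of_map_le hA hh (hn₀ i j) ?_
      exact natDegree_le_of_degree_lt_succ (mem_degreeLT.1 (p j).2)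
    let Φ : (s → degreeLT 𝕜 (n + 1)) →ₗ[𝕜] (Fin r → A (n₀ + n)) :=
      LinearMap.pi fun i => LinearMap.codRestrict _ _ (hmem i)
    have hΦ : LinearMap.ker Φ ≠ ⊥ := by
      refine LinearMap.ker_ne_bot_of_finrank_lt ?_
      rw [finrank_pi_fintype, finrank_pi_fintype, Finset.sum_const, Finset.sum_const,
        finrank_degreeLT, Finset.card_univ, Finset.card_univ, Fintype.card_fin,
        Fintype.card_coe, smul_eq_mul, smul_eq_mul]
      have h1 : r * finrank 𝕜 (A (n₀ + n)) ≤ r * (c * (n₀ + n + 1)) :=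
        Nat.mul_le_mul_left r (hc _)
      have h2 : (r * c + 1) * (n + 1) ≤ s.card * (n + 1) := Nat.mul_le_mul_right _ hlt
      have h3 : n = r * c * n₀ := rfl
      nlinarith
    obtain ⟨p, hp, hp0⟩ := Submodule.exists_mem_ne_zero_of_ne_bot hΦ
    apply hp0
    have := relation_eq_zero hδ hinj hu (fun j => j.1.2) n (fun j => (p j : 𝕜[X]))
      (fun j => natDegree_le_of_degree_lt_succ (mem_degreeLT.1 (p j).2))
      fun i hi => by
        have := congrArg Subtype.val (congrFun (LinearMap.mem_ker.1 hp) ⟨i, hi⟩)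
        simpa [Φ, polyAct_apply, LinearMap.sum_apply] using this
    funext j
    exact Subtype.ext (congrFun this j)
  exact Module.rank_lt_aleph0_iff.1 (hrank.trans_lt (Cardinal.natCast_lt_aleph0))

/-- The torsion-free case: if `V` is spanned by the spaces `𝕜[h] gᵢ`, where the `gᵢ` satisfy a
nontrivial relation, then every skew polynomial with nonzero constant term is Fredholm. -/
lemma isFred_evalSkew_of_torsionFree [CharZero 𝕜] (hδ : δ * h = (h + 1) * δ)
    (hg : ∀ i, δ (g i) = g (i + 1)) {d : 𝕜[X][X]} (hd : d ≠ 0)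
    (hrel : ∀ i : ℤ, ∑ k ∈ Finset.range (d.natDegree + 1),
      aeval h (taylor (i : 𝕜) (d.coeff k)) (g (i + k)) = 0)
    (htop : ⨆ i, LinearMap.range (polyAct h (g i)) = ⊤) {D : 𝕜[X][X]}
    (hinj : ∀ v, aeval h (D.coeff 0) v = 0 → v = 0) :
    IsFred (evalSkew h δ D) := by
  obtain ⟨Δ, hΔ⟩ := exists_natDegree_coeff_le d
  obtain ⟨E, hE⟩ := exists_natDegree_coeff_le D
  set r := d.natDegree with hr
  set A : ℕ → Submodule 𝕜 V := fun n => boxSpan h g (-n) (r + (2 * n + 1)) (n + 1) with hAdef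
  have hA : Monotone A := fun m n hmn =>
    boxSpan_le fun i h1 h2 => polySpan_le_boxSpan (by omega) (by push_cast at h2 ⊢; omega)
      (by omega)
  have hAt : ⨆ n, A n = ⊤ := by
    rw [eq_top_iff, ← htop]
    refine iSup_le fun i => ?_
    rintro _ ⟨p, rfl⟩
    refine Submodule.mem_iSup_of_mem (i.natAbs + p.natDegree) ?_
    refine polySpan_le_boxSpan (i := i) (by omega) (by omega) le_rfl
      (aeval_apply_mem_polySpan _ _ ?_)
    exact degree_le_natDegree.trans_lt (by exact_mod_cast (by omega))
  have hc : ∀ n, finrank 𝕜 (A n) ≤ (2 * Δ + r * (1 + 2 * Δ)) * (n + 1) := by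
    intro n
    refine (finrank_boxSpan_le_of_relation hd hΔ hrel _ _ _).trans ?_
    have h1 : (2 * n + 1) * Δ ≤ 2 * Δ * (n + 1) := by nlinarith
    have h2 : r * (n + 1 + (2 * n + 1) * Δ) ≤ r * (n + 1 + 2 * Δ * (n + 1)) :=
      Nat.mul_le_mul_left r (by omega)
    nlinarith
  have hh : ∀ n, (A n).map h ≤ A (n + 1) := by
    intro n
    rw [Submodule.map_le_iff_le_comap]
    refine boxSpan_le fun i h1 h2 => ?_
    rintro _ ⟨p, hp, rfl⟩
    have hp' : p.degree < (n + 1 : ℕ) := mem_degreeLT.1 hp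
    rw [Submodule.mem_comap, polyAct_apply, ← Module.End.mul_apply]
    have : h * aeval h p = aeval h (X * p) := by rw [map_mul, aeval_X]
    rw [this]
    refine polySpan_le_boxSpan (i := i) (by omega) (by push_cast at h2 ⊢; omega) le_rfl
      (aeval_apply_mem_polySpan _ _ ?_)
    exact degree_mul_lt_add hp' degree_X_le
  have hT : ∀ n, (A n).map (evalSkew h δ D) ≤ A (n + (E + D.natDegree)) := by
    intro n
    rw [Submodule.map_le_iff_le_comap]
    refine boxSpan_le fun i h1 h2 => ?_
    rintro _ ⟨p, hp, rfl⟩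
    have hp' : p.degree < (n + 1 : ℕ) := mem_degreeLT.1 hp
    rw [Submodule.mem_comap, polyAct_apply,
      evalSkew_apply_family hδ hg D p i (Nat.lt_succ_self _)]
    refine Submodule.sum_mem _ fun k hk => ?_
    have hk' := Finset.mem_range.1 hk
    refine polySpan_le_boxSpan (i := i + k) (by omega) (by push_cast at h2 ⊢; omega)
      (show n + 1 + E ≤ n + (E + D.natDegree) + 1 by omega) (aeval_apply_mem_polySpan _ _ ?_)
    exact degree_mul_lt_add (by rwa [degree_taylor]) (degree_le_of_natDegree_le (hE k))
  exact IsFred.of_linear_growth hA hAt hc hT (finite_ker_evalSkew hδ hinj hA hAt hc hh)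

end SkewPolynomials

section IntegroDifferentialRing

open Module

variable {𝕜 R : Type*} [Field 𝕜] [Ring R] [Algebra 𝕜 R]

variable (𝕜) in
/-- The ring `R` is generated by elements `x`, `d`, `s` satisfying the relations of multiplication
by the variable, derivation and integration. -/
structure IsIntegroDifferential (x d s : R) : Prop where
  adjoin_eq_top : Algebra.adjoin 𝕜 {x, d, s} = ⊤
  d_mul_s : d * s = 1
  d_mul_x : d * x = x * d + 1
  s_mul_d_mul_x : s * (d * x) = x

variable (𝕜) in
/-- The span of the elements `sⁱ (1 - s d) dʲ`. -/
def compactSpan (d s : R) : Submodule 𝕜 R :=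
  Submodule.span 𝕜 {f | ∃ i j : ℕ, f = s ^ i * ((1 - s * d) * d ^ j)}

namespace IsIntegroDifferential

variable {x d s : R}

@[elab_as_elim]
lemma induction (H : IsIntegroDifferential 𝕜 x d s) {P : R → Prop} (x : P x) (d : P d) (s : P s)
    (algebraMap : ∀ r, P (algebraMap 𝕜 R r)) (add : ∀ a b, P a → P b → P (a + b))
    (mul : ∀ a b, P a → P b → P (a * b)) (a : R) : P a := by
  refine Algebra.adjoin_induction (p := fun a _ => P a) ?_ algebraMap
    (fun a b _ _ => add a b) (fun a b _ _ => mul a b) (H.adjoin_eq_top ▸ Algebra.mem_top : a ∈ _)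
  rintro a (rfl | rfl | rfl)
  exacts [x, d, s]

lemma h_mul_s (H : IsIntegroDifferential 𝕜 x d s) : d * x * s = s * (d * x + 1) := by
  rw [mul_add, H.s_mul_d_mul_x, H.d_mul_x, add_mul, mul_assoc, H.d_mul_s, mul_one, one_mul, mul_one]

lemma d_mul_h (H : IsIntegroDifferential 𝕜 x d s) : d * (d * x) = (d * x + 1) * d := by
  rw [add_mul, one_mul, H.d_mul_x, mul_add, mul_one, ← mul_assoc, H.d_mul_x]

lemma s_mul_h (H : IsIntegroDifferential 𝕜 x d s) :
    s * (d * x) = (d * x + algebraMap 𝕜 R (-1)) * s := by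
  rw [map_neg, map_one, add_mul, H.h_mul_s, mul_add, mul_one, neg_one_mul, add_neg_cancel_right]

lemma sub_mul_s (H : IsIntegroDifferential 𝕜 x d s) : (1 - s * d) * s = 0 := by
  rw [sub_mul, mul_assoc, H.d_mul_s, one_mul, mul_one, sub_self]

lemma d_mul_sub (H : IsIntegroDifferential 𝕜 x d s) : d * (1 - s * d) = 0 := by
  rw [mul_sub, ← mul_assoc, H.d_mul_s, one_mul, mul_one, sub_self]

lemma sub_mul_h (H : IsIntegroDifferential 𝕜 x d s) : (1 - s * d) * (d * x) = 1 - s * d := by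
  rw [H.d_mul_x, mul_add, mul_one]
  nth_rw 1 [← H.s_mul_d_mul_x]
  rw [mul_assoc s, ← mul_assoc, H.sub_mul_s, zero_mul, zero_add]

/-- The right ideal generated by `1 - s d` is spanned by the elements `(1 - s d) dʲ`. -/
lemma sub_mul_mem (H : IsIntegroDifferential 𝕜 x d s) (c : R) :
    (1 - s * d) * c ∈ Submodule.span 𝕜 (Set.range fun j : ℕ => (1 - s * d) * d ^ j) := by
  set P := Submodule.span 𝕜 (Set.range fun j : ℕ => (1 - s * d) * d ^ j) with hP
  have key : ∀ c : R, (∀ j : ℕ, (1 - s * d) * d ^ j * c ∈ P) → ∀ b ∈ P, b * c ∈ P := by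
    intro c hc b hb
    have : P ≤ P.comap (LinearMap.mulRight 𝕜 c) := by
      rw [hP, Submodule.span_le]
      rintro _ ⟨j, rfl⟩
      exact hc j
    exact this hb
  have hmem : ∀ j : ℕ, (1 - s * d) * d ^ j ∈ P := fun j => Submodule.subset_span ⟨j, rfl⟩
  have hs : ∀ b ∈ P, b * s ∈ P := by
    refine key _ fun j => ?_
    cases j with
    | zero => rw [pow_zero, mul_one, H.sub_mul_s]; exact P.zero_mem
    | succ j =>
      rw [pow_succ, mul_assoc, mul_assoc, H.d_mul_s, mul_one]
      exact hmem j
  have hh : ∀ b ∈ P, b * (d * x) ∈ P := by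
    refine key _ fun j => ?_
    have h := pow_mul_aeval (𝕜 := 𝕜) H.d_mul_h j X
    rw [aeval_X, taylor_X, map_add, aeval_X, aeval_C] at h
    rw [mul_assoc, h, ← mul_assoc, mul_add, H.sub_mul_h, ← Algebra.commutes, add_mul,
      mul_assoc, ← Algebra.smul_def]
    exact P.add_mem (hmem j) (P.smul_mem _ (hmem j))
  have main : ∀ b ∈ P, b * c ∈ P := by
    induction c using H.induction with
    | x =>
      intro b hb
      rw [← H.s_mul_d_mul_x, ← mul_assoc]
      exact hh _ (hs b hb)
    | d =>
      refine key _ fun j => ?_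
      rw [mul_assoc, ← pow_succ]
      exact hmem _
    | s => exact hs
    | algebraMap r =>
      intro b hb
      rw [← Algebra.commutes, ← Algebra.smul_def]
      exact P.smul_mem _ hb
    | add a b ha hb => intro c hc; rw [mul_add]; exact P.add_mem (ha c hc) (hb c hc)
    | mul a b ha hb => intro c hc; rw [← mul_assoc]; exact hb _ (ha c hc)
  simpa using main _ (hmem 0)

/-- Left multiplication by a power of `d` brings every element of `R` into the skew polynomial
ring generated by `d x` and `d`. -/
lemma exists_pow_mul_eq_evalSkew (H : IsIntegroDifferential 𝕜 x d s) (c : R) :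
    ∃ (k : ℕ) (D : 𝕜[X][X]), d ^ k * c = evalSkew (d * x) d D := by
  let Q : R → Prop := fun c => ∃ (k : ℕ) (D : 𝕜[X][X]), d ^ k * c = evalSkew (d * x) d D
  have hpow : ∀ (n : ℕ) (D : 𝕜[X][X]), ∃ E : 𝕜[X][X],
      d ^ n * evalSkew (d * x) d D = evalSkew (d * x) d E := by
    intro n
    induction n with
    | zero => exact fun D => ⟨D, by simp⟩
    | succ n ih =>
      intro D
      obtain ⟨E, hE⟩ := ih D
      exact ⟨_, by rw [pow_succ', mul_assoc, hE, mul_evalSkew H.d_mul_h]⟩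
  suffices h : ∀ c', Q c' → Q (c * c') by
    simpa [Q] using h 1 ⟨0, 1, by simp [evalSkew]⟩
  induction c using H.induction with
  | x =>
    rintro c' ⟨k, D, hD⟩
    refine ⟨k + 1, C (taylor (k : 𝕜) X) * D, ?_⟩
    have h := pow_mul_aeval (𝕜 := 𝕜) H.d_mul_h k X
    rw [aeval_X] at h
    rw [evalSkew_C_mul, ← hD, ← mul_assoc (aeval _ _), ← h, pow_succ]
    simp only [mul_assoc]
  | d =>
    rintro c' ⟨k, D, hD⟩
    exact ⟨k, _, by rw [← mul_assoc, ← pow_succ, pow_succ', mul_assoc, hD,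
      mul_evalSkew H.d_mul_h]⟩
  | s =>
    rintro c' ⟨k, D, hD⟩
    exact ⟨k + 1, D, by rw [pow_succ, mul_assoc, ← mul_assoc d, H.d_mul_s, one_mul, hD]⟩
  | algebraMap r =>
    rintro c' ⟨k, D, hD⟩
    refine ⟨k, C (C r) * D, ?_⟩
    rw [evalSkew_C_mul, aeval_C, ← hD, ← mul_assoc, ← Algebra.commutes, mul_assoc]
  | add a b ha hb =>
    intro c' hc'
    obtain ⟨k, D, hD⟩ := ha c' hc'
    obtain ⟨l, E, hE⟩ := hb c' hc'
    obtain ⟨D', hD'⟩ := hpow l D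
    obtain ⟨E', hE'⟩ := hpow k E
    refine ⟨k + l, D' + E', ?_⟩
    rw [add_mul, mul_add, evalSkew_add, ← hD', ← hE', ← hD, ← hE, ← mul_assoc (d ^ l),
      ← mul_assoc (d ^ k), ← pow_add, ← pow_add, add_comm l k]
  | mul a b ha hb => intro c' hc'; rw [mul_assoc]; exact ha _ (hb _ hc')

/-- Elements killed by a power of `d` on the left are compact. -/
lemma mem_compactSpan_of_pow_mul_eq_zero (H : IsIntegroDifferential 𝕜 x d s) {k : ℕ} {a : R}
    (h : d ^ k * a = 0) :
    a ∈ compactSpan 𝕜 d s := by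
  induction k generalizing a with
  | zero =>
    rw [pow_zero, one_mul] at h
    rw [h]
    exact (compactSpan 𝕜 d s).zero_mem
  | succ k ih =>
    rw [pow_succ, mul_assoc] at h
    have h1 : a = (1 - s * d) * a + s * (d * a) := by
      rw [sub_mul, one_mul, mul_assoc, sub_add_cancel]
    have h2 : Submodule.span 𝕜 (Set.range fun j : ℕ => (1 - s * d) * d ^ j) ≤
        compactSpan 𝕜 d s := by
      rw [Submodule.span_le]
      rintro _ ⟨j, rfl⟩
      exact Submodule.subset_span ⟨0, j, by rw [pow_zero, one_mul]⟩
    have h3 : compactSpan 𝕜 d s ≤ (compactSpan 𝕜 d s).comap (LinearMap.mulLeft 𝕜 s) := by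
      conv_lhs => rw [compactSpan]
      rw [Submodule.span_le]
      rintro _ ⟨i, j, rfl⟩
      exact Submodule.subset_span ⟨i + 1, j, by
        rw [LinearMap.mulLeft_apply, ← mul_assoc, ← pow_succ']⟩
    rw [h1]
    exact (compactSpan 𝕜 d s).add_mem (h2 (H.sub_mul_mem a)) (h3 (ih h))

end IsIntegroDifferential

variable {V : Type*} [AddCommGroup V] [Module R V] [Module 𝕜 V] [IsScalarTower 𝕜 R V]

/-- The family `…, s² v, s v, v, d v, d² v, …`, indexed by `ℤ`. -/
def powFamily (d s : R) (v : V) : ℤ → V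
  | Int.ofNat n => d ^ n • v
  | Int.negSucc n => s ^ (n + 1) • v

lemma powFamily_natCast (d s : R) (v : V) (n : ℕ) : powFamily d s v n = d ^ n • v := rfl

lemma powFamily_neg (d s : R) (v : V) (n : ℕ) : powFamily d s v (-n) = s ^ n • v := by
  cases n with
  | zero => rw [pow_zero, ← pow_zero d]; rfl
  | succ n => rfl

namespace IsIntegroDifferential

variable {x d s : R}

lemma d_smul_powFamily (H : IsIntegroDifferential 𝕜 x d s) (v : V) (i : ℤ) :
    d • powFamily d s v i = powFamily d s v (i + 1) := by
  obtain ⟨n, rfl | rfl⟩ := i.eq_nat_or_neg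
  · rw [← Nat.cast_succ, powFamily_natCast, powFamily_natCast, smul_smul, pow_succ']
  · cases n with
    | zero => rw [Nat.cast_zero, neg_zero, zero_add, ← Nat.cast_zero, ← Nat.cast_one,
        powFamily_natCast, powFamily_natCast, pow_zero, one_smul, pow_one]
    | succ n => rw [show (-(n + 1 : ℕ) + 1 : ℤ) = -n by push_cast; ring, powFamily_neg,
        powFamily_neg, smul_smul, pow_succ', ← mul_assoc, H.d_mul_s, one_mul]

lemma s_smul_powFamily_of_nonpos (v : V) {i : ℤ} (hi : i ≤ 0) :
    s • powFamily d s v i = powFamily d s v (i - 1) := by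
  obtain ⟨n, rfl⟩ := Int.exists_eq_neg_ofNat hi
  rw [show (-n - 1 : ℤ) = -(n + 1 : ℕ) by push_cast; ring, powFamily_neg, powFamily_neg,
    smul_smul, pow_succ']

lemma s_smul_powFamily (hsd : ∀ v : V, s • d • v = v) (v : V) (i : ℤ) :
    s • powFamily d s v i = powFamily d s v (i - 1) := by
  rcases le_or_gt i 0 with hi | hi
  · exact s_smul_powFamily_of_nonpos v hi
  · obtain ⟨n, rfl⟩ := Int.eq_succ_of_zero_lt hi
    rw [add_sub_cancel_right, ← Nat.cast_succ, powFamily_natCast, powFamily_natCast, pow_succ',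
      mul_smul, hsd]

lemma s_smul_powFamily_of_d_smul_eq_zero {v : V} (hv : d • v = 0) (i : ℤ) :
    s • powFamily d s v i = powFamily d s v (i - 1) ∨ s • powFamily d s v i = 0 := by
  rcases le_or_gt i 0 with hi | hi
  · exact Or.inl (s_smul_powFamily_of_nonpos v hi)
  · obtain ⟨n, rfl⟩ := Int.eq_succ_of_zero_lt hi
    right
    rw [← Nat.cast_succ, powFamily_natCast, pow_succ, mul_smul, hv, smul_zero, smul_zero]

lemma s_pow_mul_aeval (H : IsIntegroDifferential 𝕜 x d s) (n : ℕ) (p : 𝕜[X]) :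
    s ^ n * aeval (d * x) p = aeval (d * x) (taylor (-n : 𝕜) p) * s ^ n := by
  induction n with
  | zero => simp
  | succ n ih =>
    rw [pow_succ', mul_assoc, ih, ← mul_assoc, mul_aeval_of_mul_eq H.s_mul_h, ← aeval_taylor,
      taylor_taylor, mul_assoc, ← pow_succ']
    push_cast
    rw [neg_add_rev]

/-- Relations among the members of `powFamily` can be shifted. -/
lemma aeval_taylor_smul_powFamily_sum (H : IsIntegroDifferential 𝕜 x d s) {v : V} {n : ℕ}
    (hsd : ∀ i : ℤ, i < n → s • powFamily d s v i = powFamily d s v (i - 1)) {c : ℕ → 𝕜[X]}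
    (hc : ∑ k ∈ Finset.range n, aeval (d * x) (c k) • d ^ k • v = 0) (i : ℤ) :
    ∑ k ∈ Finset.range n,
      aeval (d * x) (taylor (i : 𝕜) (c k)) • powFamily d s v (i + k) = 0 := by
  obtain ⟨m, rfl | rfl⟩ := i.eq_nat_or_neg
  · have := congrArg (d ^ m • ·) hc
    simp only [smul_zero, Finset.smul_sum] at this
    rw [← this]
    refine Finset.sum_congr rfl fun k _ => ?_
    rw [← Nat.cast_add, powFamily_natCast, smul_smul (d ^ m), pow_mul_aeval H.d_mul_h, mul_smul,
      smul_smul (d ^ m), ← pow_add, Int.cast_natCast]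
  · have hs : ∀ (m : ℕ) (j : ℤ), j < n → s ^ m • powFamily d s v j = powFamily d s v (j - m) := by
      intro m j hj
      induction m with
      | zero => simp
      | succ m ih =>
        rw [pow_succ', mul_smul, ih, hsd _ (by omega)]
        push_cast
        rw [sub_sub]
    have := congrArg (s ^ m • ·) hc
    simp only [smul_zero, Finset.smul_sum] at this
    rw [← this]
    refine Finset.sum_congr rfl fun k hk => ?_
    rw [← powFamily_natCast d s, smul_smul (s ^ m), H.s_pow_mul_aeval, mul_smul,
      hs _ _ (by exact_mod_cast Finset.mem_range.1 hk), neg_add_eq_sub, Int.cast_neg,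
      Int.cast_natCast]

/-- In a simple module, the spaces `𝕜[h] gᵢ` attached to a nonzero vector fill everything. -/
lemma iSup_range_polyAct_eq_top [IsSimpleModule R V] (H : IsIntegroDifferential 𝕜 x d s) {v : V}
    (hv : v ≠ 0) (hs : ∀ i : ℤ, s • powFamily d s v i = powFamily d s v (i - 1) ∨
      s • powFamily d s v i = 0) :
    ⨆ i, LinearMap.range (polyAct (Algebra.lsmul 𝕜 𝕜 V (d * x)) (powFamily d s v i)) = ⊤ := by
  set S := ⨆ i, LinearMap.range (polyAct (Algebra.lsmul 𝕜 𝕜 V (d * x)) (powFamily d s v i))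
    with hS
  have hmem : ∀ (i : ℤ) (p : 𝕜[X]), aeval (d * x) p • powFamily d s v i ∈ S := by
    intro i p
    refine Submodule.mem_iSup_of_mem i ⟨p, ?_⟩
    rw [polyAct_apply, aeval_algHom_apply]
    rfl
  have key : ∀ c : R, (∀ (i : ℤ) (p : 𝕜[X]), c • aeval (d * x) p • powFamily d s v i ∈ S) →
      ∀ w ∈ S, c • w ∈ S := by
    intro c hc w hw
    have : S ≤ S.comap (Algebra.lsmul 𝕜 𝕜 V c) := by
      conv_lhs => rw [hS]
      refine iSup_le fun i => ?_
      rintro _ ⟨p, rfl⟩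
      rw [polyAct_apply, aeval_algHom_apply]
      exact hc i p
    exact this hw
  have hS' : ∀ w ∈ S, s • w ∈ S := by
    refine key _ fun i p => ?_
    have := H.s_pow_mul_aeval 1 p
    rw [pow_one] at this
    rw [smul_smul, this, mul_smul]
    rcases hs i with h | h <;> rw [h]
    · exact hmem _ _
    · rw [smul_zero]; exact S.zero_mem
  have hstable : ∀ (c : R) (w : V), w ∈ S → c • w ∈ S := by
    intro c
    induction c using H.induction with
    | x =>
      intro w hw
      rw [← H.s_mul_d_mul_x, mul_smul]
      refine hS' _ (key _ (fun i p => ?_) w hw)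
      rw [smul_smul, show d * x * aeval (d * x) p = aeval (d * x) (X * p) by
        rw [map_mul, aeval_X]]
      exact hmem _ _
    | d =>
      refine key _ fun i p => ?_
      rw [smul_smul, mul_aeval H.d_mul_h, mul_smul, H.d_smul_powFamily]
      exact hmem _ _
    | s => exact hS'
    | algebraMap r => intro w hw; rw [algebraMap_smul]; exact S.smul_mem r hw
    | add a b ha hb => intro w hw; rw [add_smul]; exact S.add_mem (ha w hw) (hb w hw)
    | mul a b ha hb => intro w hw; rw [mul_smul]; exact ha _ (hb w hw)
  rw [eq_top_iff]
  intro w _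
  obtain ⟨c, rfl⟩ := IsSimpleModule.toSpanSingleton_surjective R hv w
  refine hstable c v ?_
  have := hmem 0 1
  rwa [map_one, one_smul, ← Nat.cast_zero, powFamily_natCast, pow_zero, one_smul] at this

lemma isFred_lsmul_d [IsSimpleModule R V] (H : IsIntegroDifferential 𝕜 x d s) :
    IsFred (Algebra.lsmul 𝕜 𝕜 V d) := by
  refine ⟨?_, ?_⟩
  · by_cases h : ∃ v : V, v ≠ 0 ∧ d • v = 0
    · obtain ⟨v, hv, hdv⟩ := h
      refine Submodule.finiteDimensional_of_le (S₂ := Submodule.span 𝕜 {v}) fun u hu => ?_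
      obtain ⟨c, hc⟩ := IsSimpleModule.toSpanSingleton_surjective R hv u
      have hu' : (1 - s * d) • u = u := by
        rw [sub_smul, one_smul, mul_smul, show d • u = 0 from hu, smul_zero, sub_zero]
      rw [← hu', ← hc, LinearMap.toSpanSingleton_apply, smul_smul]
      have hle : Submodule.span 𝕜 (Set.range fun j : ℕ => (1 - s * d) * d ^ j) ≤
          (Submodule.span 𝕜 {v}).comap (LinearMap.toSpanSingleton R V v |>.restrictScalars 𝕜) := by
        rw [Submodule.span_le]
        rintro _ ⟨j, rfl⟩
        change ((1 - s * d) * d ^ j) • v ∈ Submodule.span 𝕜 {v}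
        cases j with
        | zero =>
          rw [pow_zero, mul_one, sub_smul, one_smul, mul_smul, hdv, smul_zero, sub_zero]
          exact Submodule.mem_span_singleton_self v
        | succ j =>
          rw [pow_succ, ← mul_assoc, mul_smul, hdv, smul_zero]
          exact Submodule.zero_mem _
      exact hle (H.sub_mul_mem c)
    · push Not at h
      have : LinearMap.ker (Algebra.lsmul 𝕜 𝕜 V d) = ⊥ :=
        (Submodule.eq_bot_iff _).2 fun v hv => by_contra fun hv0 => h v hv0 hv
      rw [this]
      infer_instance
  · have : LinearMap.range (Algebra.lsmul 𝕜 𝕜 V d) = ⊤ :=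
      LinearMap.range_eq_top.2 fun v => ⟨s • v, by
        change d • s • v = v
        rw [smul_smul, H.d_mul_s, one_smul]⟩
    rw [this]
    infer_instance

lemma isFred_evalSkew_of_aeval_smul_eq_zero [CharZero 𝕜] [IsSimpleModule R V]
    (H : IsIntegroDifferential 𝕜 x d s) {v : V} (hv : v ≠ 0)
    (hs : ∀ i : ℤ, s • powFamily d s v i = powFamily d s v (i - 1) ∨
      s • powFamily d s v i = 0) {p : 𝕜[X]} (hp : p ≠ 0) (hpv : aeval (d * x) p • v = 0)
    {D : 𝕜[X][X]} (hD : D.coeff 0 ≠ 0) :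
    IsFred (Algebra.lsmul 𝕜 𝕜 V (evalSkew (d * x) d D)) := by
  rw [map_evalSkew]
  refine isFred_evalSkew_of_torsion ?_ (H.d_smul_powFamily v) hp (fun i => ?_)
    (H.iSup_range_polyAct_eq_top hv hs) hD
  · rw [← map_mul, H.d_mul_h, map_mul, map_add, map_one]
  · have := H.aeval_taylor_smul_powFamily_sum (v := v) (n := 1) (c := fun _ => p)
      (fun i hi => s_smul_powFamily_of_nonpos v (by omega)) (by simpa using hpv) i
    rw [aeval_algHom_apply]
    simpa using this

/-- On a simple module without `h`-torsion, some vector satisfies a nontrivial skew polynomial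
equation. -/
lemma exists_evalSkew_smul_eq_zero [IsSimpleModule R V]
    (H : IsIntegroDifferential 𝕜 x d s) {v : V} (hv : (d * x) • v ≠ 0) :
    ∃ D : 𝕜[X][X], D ≠ 0 ∧ evalSkew (d * x) d D • v = 0 := by
  obtain ⟨c, hc⟩ := IsSimpleModule.toSpanSingleton_surjective R hv v
  rw [LinearMap.toSpanSingleton_apply] at hc
  obtain ⟨l, B, hB⟩ := H.exists_pow_mul_eq_evalSkew c
  set B' : 𝕜[X][X] := ∑ i ∈ Finset.range (B.natDegree + 1),
    monomial i (B.coeff i * taylor (i : 𝕜) X) with hB'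
  have hmul : evalSkew (d * x) d B * (d * x) = evalSkew (d * x) d B' := by
    have hsum : evalSkew (d * x) d B' = ∑ i ∈ Finset.range (B.natDegree + 1),
        evalSkew (d * x) d (monomial i (B.coeff i * taylor (i : 𝕜) X)) :=
      eval₂_finsetSum _ _ _ _
    rw [hsum, evalSkew_eq_sum _ _ _ (Nat.lt_succ_self _), Finset.sum_mul]
    refine Finset.sum_congr rfl fun i _ => ?_
    have h := pow_mul_aeval (𝕜 := 𝕜) H.d_mul_h i X
    rw [aeval_X] at h
    rw [evalSkew_monomial, mul_assoc, h, map_mul, mul_assoc]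
  refine ⟨B' - monomial l 1, fun h0 => ?_, ?_⟩
  · have h1 : (B'.coeff l).eval (-l : 𝕜) = 0 := by
      rw [hB', finsetSum_coeff, eval_finsetSum]
      refine Finset.sum_eq_zero fun i _ => ?_
      rw [coeff_monomial]
      split_ifs with hi
      · simp [hi]
      · simp
    have h2 := congrArg (fun D : 𝕜[X][X] => (D.coeff l).eval (-l : 𝕜)) h0
    simp [h1] at h2
  · rw [evalSkew_sub, evalSkew_monomial, map_one, one_mul, sub_smul, ← hmul, ← hB, mul_smul,
      mul_smul, hc, sub_self]

lemma isFred_evalSkew [CharZero 𝕜] [IsSimpleModule R V] (H : IsIntegroDifferential 𝕜 x d s)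
    {D : 𝕜[X][X]} (hD : D.coeff 0 ≠ 0) :
    IsFred (Algebra.lsmul 𝕜 𝕜 V (evalSkew (d * x) d D)) := by
  by_cases hd : ∃ v : V, v ≠ 0 ∧ d • v = 0
  · obtain ⟨v, hv, hdv⟩ := hd
    refine H.isFred_evalSkew_of_aeval_smul_eq_zero hv (s_smul_powFamily_of_d_smul_eq_zero hdv)
      (X_sub_C_ne_zero (1 : 𝕜)) ?_ hD
    rw [map_sub, aeval_X, aeval_C, map_one, H.d_mul_x, add_sub_cancel_right, mul_smul, hdv,
      smul_zero]
  push Not at hd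
  have hsd : ∀ v : V, s • d • v = v := fun v => by
    by_contra h
    refine hd (s • d • v - v) (sub_ne_zero.2 h) ?_
    rw [smul_sub, smul_smul, H.d_mul_s, one_smul, sub_self]
  have hs := fun v : V => s_smul_powFamily hsd v
  by_cases hp : ∃ (v : V) (p : 𝕜[X]), v ≠ 0 ∧ p ≠ 0 ∧ aeval (d * x) p • v = 0
  · obtain ⟨v, p, hv, hp, hpv⟩ := hp
    exact H.isFred_evalSkew_of_aeval_smul_eq_zero hv (fun i => Or.inl (hs v i)) hp hpv hD
  push Not at hp
  have := IsSimpleModule.nontrivial R V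
  obtain ⟨v, hv⟩ := exists_ne (0 : V)
  obtain ⟨B, hB, hBv⟩ := H.exists_evalSkew_smul_eq_zero (v := v) (by
    simpa using hp v X hv X_ne_zero)
  rw [map_evalSkew]
  refine isFred_evalSkew_of_torsionFree ?_ (H.d_smul_powFamily v) hB (fun i => ?_)
    (H.iSup_range_polyAct_eq_top hv fun i => Or.inl (hs v i)) fun w hw => ?_
  · rw [← map_mul, H.d_mul_h, map_mul, map_add, map_one]
  · rw [evalSkew_eq_sum _ _ _ (Nat.lt_succ_self _), Finset.sum_smul] at hBv
    simp only [mul_smul] at hBv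
    rw [← H.aeval_taylor_smul_powFamily_sum (fun i _ => hs v i) hBv i]
    refine Finset.sum_congr rfl fun k _ => ?_
    rw [aeval_algHom_apply]
    rfl
  · rw [aeval_algHom_apply] at hw
    by_contra hw0
    exact hp w _ hw0 hD hw

/-- Non-compact elements act as Fredholm maps on simple modules. -/
lemma isFred_lsmul_of_isSimpleModule [CharZero 𝕜] [IsSimpleModule R V]
    (H : IsIntegroDifferential 𝕜 x d s) {a : R} (ha : a ∉ compactSpan 𝕜 d s) :
    IsFred (Algebra.lsmul 𝕜 𝕜 V a) := by
  obtain ⟨k, D, hD⟩ := H.exists_pow_mul_eq_evalSkew a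
  have hD0 : D ≠ 0 := by
    rintro rfl
    exact ha (H.mem_compactSpan_of_pow_mul_eq_zero (hD.trans (evalSkew_zero _ _)))
  obtain ⟨E, n, hE, rfl⟩ := exists_eq_mul_X_pow hD0
  have hd := H.isFred_lsmul_d (V := V)
  refine IsFred.of_comp_left (S := Algebra.lsmul 𝕜 𝕜 V d ^ k) ?_ (hd.pow k)
  rw [← Module.End.mul_eq_comp, ← map_pow, ← map_mul, hD, evalSkew_mul_X_pow, map_mul, map_pow,
    Module.End.mul_eq_comp]
  exact (H.isFred_evalSkew hE).comp (hd.pow n)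

end IsIntegroDifferential

universe u v w

lemma isFred_lsmul_of_isFiniteLength {𝕜 : Type u} {R : Type v} [Field 𝕜] [Ring R] [Algebra 𝕜 R]
    {a : R} (ha : ∀ (V : Type w) [AddCommGroup V] [Module R V] [Module 𝕜 V]
      [IsScalarTower 𝕜 R V] [IsSimpleModule R V], IsFred (Algebra.lsmul 𝕜 𝕜 V a))
    {V : Type w} [AddCommGroup V] [Module R V] [Module 𝕜 V] [IsScalarTower 𝕜 R V]
    (hV : IsFiniteLength R V) : IsFred (Algebra.lsmul 𝕜 𝕜 V a) := by
  revert ‹Module 𝕜 V›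
  induction hV with
  | of_subsingleton =>
    intro _ _
    exact ⟨inferInstance, inferInstance⟩
  | of_simple_quotient hN ih =>
    rename_i V _ _ N _
    intro _ _
    exact IsFred.of_submodule_quotient (N := N.restrictScalars 𝕜)
      (TN := Algebra.lsmul 𝕜 𝕜 N a) (TQ := Algebra.lsmul 𝕜 𝕜 (V ⧸ N) a)
      (fun _ => rfl) (fun _ => rfl) ih (ha (V ⧸ N))

/-- Compact elements act by maps of finite rank on modules of finite length. -/
lemma IsIntegroDifferential.finiteDimensional_range_lsmul {x d s : R}
    (H : IsIntegroDifferential 𝕜 x d s) (hV : IsFiniteLength R V) {f : R}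
    (hf : f ∈ compactSpan 𝕜 d s) :
    FiniteDimensional 𝕜 (LinearMap.range (Algebra.lsmul 𝕜 𝕜 V f)) := by
  have := (isFred_lsmul_of_isFiniteLength (𝕜 := 𝕜) (fun V => H.isFred_lsmul_d (V := V)) hV).ker
  induction hf using Submodule.span_induction with
  | mem f hf =>
    obtain ⟨i, j, rfl⟩ := hf
    refine Submodule.finiteDimensional_of_le (S₂ := (LinearMap.ker (Algebra.lsmul 𝕜 𝕜 V d)).map
      (Algebra.lsmul 𝕜 𝕜 V (s ^ i))) ?_
    rintro _ ⟨v, rfl⟩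
    refine ⟨((1 - s * d) * d ^ j) • v, ?_, ?_⟩
    · change d • ((1 - s * d) * d ^ j) • v = 0
      rw [smul_smul, ← mul_assoc, H.d_mul_sub, zero_mul, zero_smul]
    · exact smul_smul _ _ _
  | zero =>
    rw [map_zero, LinearMap.range_zero]
    infer_instance
  | add f g _ _ hf hg =>
    rw [map_add]
    exact Submodule.finiteDimensional_of_le (LinearMap.range_add_le _ _)
  | smul c f _ hf =>
    rw [map_smul]
    refine Submodule.finiteDimensional_of_le
      (S₂ := LinearMap.range (Algebra.lsmul 𝕜 𝕜 V f)) ?_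
    rintro _ ⟨v, rfl⟩
    exact Submodule.smul_mem _ c ⟨v, rfl⟩

end IntegroDifferentialRing

lemma intOp_monomial (n : ℕ) (c : K) :
    intOp K (monomial n c) = monomial (n + 1) (((n : K) + 1)⁻¹ * c) := by
  have h : monomial n c = c • (Polynomial.basisMonomials K) n := by
    rw [coe_basisMonomials, smul_monomial, smul_eq_mul, mul_one]
  rw [h, map_smul, intOp, Module.Basis.constr_basis, X_pow_eq_monomial, smul_monomial,
    smul_monomial]
  simp [mul_comm]

lemma derOp_mul_intOp : derOp K * intOp K = 1 := by
  refine Polynomial.lhom_ext' fun n => LinearMap.ext fun c => ?_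
  have : (n : K) + 1 ≠ 0 := Nat.cast_add_one_ne_zero n
  rw [LinearMap.comp_apply, LinearMap.comp_apply, Module.End.mul_apply, intOp_monomial, derOp,
    derivative_monomial, Module.End.one_apply]
  congr 1
  push_cast
  field_simp

lemma derOp_mul_xOp : derOp K * xOp K = xOp K * derOp K + 1 := by
  refine LinearMap.ext fun p => ?_
  rw [LinearMap.add_apply, Module.End.mul_apply, Module.End.mul_apply, Module.End.one_apply,
    xOp, LinearMap.mulLeft_apply, LinearMap.mulLeft_apply, derOp, derivative_mul, derivative_X,
    one_mul, add_comm]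

lemma intOp_mul_derOp_mul_xOp : intOp K * (derOp K * xOp K) = xOp K := by
  refine Polynomial.lhom_ext' fun n => LinearMap.ext fun c => ?_
  have : (n : K) + 1 ≠ 0 := Nat.cast_add_one_ne_zero n
  rw [LinearMap.comp_apply, LinearMap.comp_apply, Module.End.mul_apply, Module.End.mul_apply,
    xOp, LinearMap.mulLeft_apply, derOp, X_mul_monomial, derivative_monomial,
    Nat.add_sub_cancel, intOp_monomial]
  congr 1
  push_cast
  field_simp

lemma isIntegroDifferential_I1 :
    IsIntegroDifferential K (⟨xOp K, xOp_mem K⟩ : I1 K) (derI K) (intI K) where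
  adjoin_eq_top := by
    refine Subalgebra.map_injective (f := (I1 K).val) Subtype.val_injective ?_
    rw [AlgHom.map_adjoin, Algebra.map_top, Subalgebra.range_val, Set.image_insert_eq,
      Set.image_pair]
    rfl
  d_mul_s := Subtype.ext (derOp_mul_intOp K)
  d_mul_x := Subtype.ext (derOp_mul_xOp K)
  s_mul_d_mul_x := Subtype.ext (intOp_mul_derOp_mul_xOp K)

lemma eOp_eq (i j : ℕ) :
    eOp K i j = intOp K ^ i * ((1 - intOp K * derOp K) * derOp K ^ j) := by
  rw [eOp, sub_mul, one_mul, mul_sub, pow_succ, pow_succ', mul_assoc, mul_assoc]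

variable {K}

lemma mem_Fset_iff {a : I1 K} :
    (a : Module.End K K[X]) ∈ Fset K ↔ a ∈ compactSpan K (derI K) (intI K) := by
  have h : Fset K = (compactSpan K (derI K) (intI K)).map (I1 K).val.toLinearMap := by
    rw [Fset, compactSpan, Submodule.map_span]
    congr 1
    ext f
    constructor
    · rintro ⟨i, j, rfl⟩
      exact ⟨_, ⟨i, j, rfl⟩, (eOp_eq K i j).symm⟩
    · rintro ⟨_, ⟨i, j, rfl⟩, rfl⟩
      exact ⟨i, j, (eOp_eq K i j).symm⟩
  rw [h, Submodule.mem_map]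
  exact ⟨fun ⟨b, hb, e⟩ => Subtype.ext e ▸ hb, fun ha => ⟨a, ha, rfl⟩⟩

variable (K)

/-- the `M`-index of a non-compact operator is invariant under addition of a
compact operator `f ∈ F`. -/
theorem statement5 (a f : I1 K)
    (ha : (a : Module.End K (Polynomial K)) ∉ Fset K)
    (hf : (f : Module.End K (Polynomial K)) ∈ Fset K)
    (M : Type*) [AddCommGroup M] [Nontrivial M]
    [Module (I1 K) M] [Module K M] [IsScalarTower K (I1 K) M] [SMulCommClass K (I1 K) M]
    (hM : IsFiniteLength (I1 K) M) :
    FiniteDimensional K ↥(LinearMap.ker (actMap K a M))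
    ∧ FiniteDimensional K (M ⧸ LinearMap.range (actMap K a M))
    ∧ FiniteDimensional K ↥(LinearMap.ker (actMap K (a + f) M))
    ∧ FiniteDimensional K (M ⧸ LinearMap.range (actMap K (a + f) M))
    ∧ (Module.finrank K ↥(LinearMap.ker (actMap K (a + f) M)) : ℤ) -
        Module.finrank K (M ⧸ LinearMap.range (actMap K (a + f) M)) =
      (Module.finrank K ↥(LinearMap.ker (actMap K a M)) : ℤ) -
        Module.finrank K (M ⧸ LinearMap.range (actMap K a M)) := by
  have H := isIntegroDifferential_I1 K
  have hT : IsFred (actMap K a M) := isFred_lsmul_of_isFiniteLength (𝕜 := K)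
    (fun V => H.isFred_lsmul_of_isSimpleModule (V := V) (mt mem_Fset_iff.2 ha)) hM
  have hS : FiniteDimensional K (LinearMap.range (actMap K f M)) :=
    H.finiteDimensional_range_lsmul hM (mem_Fset_iff.1 hf)
  have hadd : actMap K (a + f) M = actMap K a M + actMap K f M :=
    LinearMap.ext fun m => add_smul a f m
  have hTS := hT.add_finite_range (S := actMap K f M)
  rw [hadd]
  exact ⟨hT.ker, hT.coker, hTS.ker, hTS.coker, hT.index_add_finite_range⟩

end
end

section
/- For every a ∈ I₁: the left I₁-modules ker(·a) = {b ∈ I₁ : ba = 0} and I₁/I₁a are finitely generated, and the right I₁-modules ker(a·) = {b ∈ I₁ : ab = 0} and I₁/aI₁ are finitely generated. -/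
open Polynomial

noncomputable section
set_option synthInstance.maxHeartbeats 1000000
set_option maxHeartbeats 1000000
set_option linter.unusedSectionVars false

variable (K : Type*) [Field K] [CharZero K]

/-- The cokernel `R ⧸ Im f` of a homomorphism of left `R`-modules `f : R → R`. -/
abbrev Coker (R : Type*) [Ring R] (f : R →ₗ[R] R) : Type _ := R ⧸ LinearMap.range f

/-- The cokernel `R ⧸ Im f` of a homomorphism of right `R`-modules `f : R → R`. -/
abbrev CokerOp (R : Type*) [Ring R] (f : R →ₗ[Rᵐᵒᵖ] R) : Type _ := R ⧸ LinearMap.range f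

/-- The divided power `xⁿ / n!`. -/
def dpow (n : ℕ) : K[X] := monomial n ((n.factorial : K)⁻¹)

lemma intOp_dpow (n : ℕ) : intOp K (dpow K n) = dpow K (n + 1) := by
  have h : dpow K n = (n.factorial : K)⁻¹ • Polynomial.basisMonomials K n := by
    simp [dpow, smul_monomial]
  rw [h, map_smul, intOp, Module.Basis.constr_basis, dpow, smul_smul, ← C_mul_X_pow_eq_monomial,
    smul_eq_C_mul]
  congr 2
  rw [Nat.factorial_succ]
  push_cast
  rw [mul_inv, mul_comm]

lemma derOp_dpow_zero : derOp K (dpow K 0) = 0 := by simp [derOp, dpow]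

lemma derOp_dpow_succ (n : ℕ) : derOp K (dpow K (n + 1)) = dpow K n := by
  have h : ((n : K) + 1) ≠ 0 := by exact_mod_cast n.succ_ne_zero
  simp only [derOp, dpow, derivative_monomial, Nat.add_sub_cancel, Nat.factorial_succ]
  congr 1
  push_cast
  field_simp

lemma xOp_dpow (n : ℕ) : xOp K (dpow K n) = ((n : K) + 1) • dpow K (n + 1) := by
  have h : ((n : K) + 1) ≠ 0 := by exact_mod_cast n.succ_ne_zero
  simp only [xOp, dpow, LinearMap.mulLeft_apply, X_mul_monomial, smul_monomial,
    Nat.factorial_succ]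
  congr 1
  push_cast
  rw [mul_inv, smul_eq_mul, mul_inv_cancel_left₀ h]

lemma degree_dpow (n : ℕ) : (dpow K n).degree = n :=
  degree_monomial n (inv_ne_zero (by exact_mod_cast n.factorial_ne_zero))

variable {K} in
lemma ext_dpow {M : Type*} [AddCommGroup M] [Module K M] {f g : K[X] →ₗ[K] M}
    (h : ∀ n, f (dpow K n) = g (dpow K n)) : f = g := by
  refine (Polynomial.basisMonomials K).ext fun n => ?_
  have hn : (n.factorial : K) ≠ 0 := by exact_mod_cast n.factorial_ne_zero
  have e : Polynomial.basisMonomials K n = (n.factorial : K) • dpow K n := by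
    simp [dpow, smul_monomial, hn]
  rw [e, map_smul, map_smul, h]

lemma intOp_pow_dpow (M n : ℕ) : (intOp K ^ M) (dpow K n) = dpow K (n + M) := by
  induction M with
  | zero => simp
  | succ M ih => rw [pow_succ', Module.End.mul_apply, ih, intOp_dpow, add_assoc]

lemma derOp_pow_mul_intOp_pow (M : ℕ) : derOp K ^ M * intOp K ^ M = 1 :=
  pow_mul_pow_eq_one M (derOp_mul_intOp K)

lemma eOp_zero_apply (f : K[X]) : eOp K 0 0 f = C (f.coeff 0) := by
  have h : eOp K 0 0 = (monomial 0).comp (lcoeff K 0) := by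
    refine ext_dpow fun n => ?_
    have he : eOp K 0 0 (dpow K n) = dpow K n - intOp K (derOp K (dpow K n)) := by simp [eOp]
    rw [he]
    cases n with
    | zero => rw [derOp_dpow_zero, map_zero, sub_zero]; simp [dpow]
    | succ n => rw [derOp_dpow_succ, intOp_dpow, sub_self]; simp [dpow, coeff_monomial]
  rw [h]
  rfl

lemma sum_intOp_eOp_derOp (M : ℕ) :
    ∑ j ∈ Finset.range M, intOp K ^ j * eOp K 0 0 * derOp K ^ j
      = 1 - intOp K ^ M * derOp K ^ M := by
  induction M with
  | zero => simp
  | succ M ih =>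
    have h : intOp K ^ M * eOp K 0 0 * derOp K ^ M
        = intOp K ^ M * derOp K ^ M - intOp K ^ (M + 1) * derOp K ^ (M + 1) := by
      rw [eOp, pow_succ _ M, pow_succ' _ M]
      simp only [pow_zero, zero_add, pow_one, mul_sub, sub_mul, mul_one, mul_assoc]
    rw [Finset.sum_range_succ, ih, h, sub_add_sub_cancel]

variable {K}

/-- The value at `xⁿ / n!` of the operator `∑ ∫ᵏ p_k(x∂)`. -/
def bandEval (n : ℕ) : (ℕ →₀ K[X]) →ₗ[K] K[X] :=
  Finsupp.lsum K fun k => (leval (n : K)).smulRight (dpow K (n + k))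

lemma bandEval_single (n k : ℕ) (q : K[X]) :
    bandEval n (Finsupp.single k q) = q.eval (n : K) • dpow K (n + k) := by
  simp [bandEval, leval]

/-- `b` acts on the divided powers of large degree through finitely many diagonals with
polynomial entries. -/
def IsEventuallyBand (b : Module.End K K[X]) : Prop :=
  ∃ (M : ℕ) (p : ℕ →₀ K[X]), ∀ n, b (dpow K (n + M)) = bandEval n p

lemma exists_xOp_bandEval (p : ℕ →₀ K[X]) :
    ∃ q : ℕ →₀ K[X], ∀ n, xOp K (bandEval n p) = bandEval n q := by
  induction p using Finsupp.induction_linear with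
  | zero => exact ⟨0, by simp⟩
  | add f g hf hg =>
    obtain ⟨f', hf⟩ := hf
    obtain ⟨g', hg⟩ := hg
    exact ⟨f' + g', fun n => by simp [hf, hg]⟩
  | single k q =>
    refine ⟨Finsupp.single (k + 1) (q * (X + C ((k : K) + 1))), fun n => ?_⟩
    rw [bandEval_single, bandEval_single, map_smul, xOp_dpow, smul_smul, add_assoc]
    simp [add_assoc]

lemma exists_intOp_bandEval (p : ℕ →₀ K[X]) :
    ∃ q : ℕ →₀ K[X], ∀ n, intOp K (bandEval n p) = bandEval n q := by
  induction p using Finsupp.induction_linear with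
  | zero => exact ⟨0, by simp⟩
  | add f g hf hg =>
    obtain ⟨f', hf⟩ := hf
    obtain ⟨g', hg⟩ := hg
    exact ⟨f' + g', fun n => by simp [hf, hg]⟩
  | single k q =>
    refine ⟨Finsupp.single (k + 1) q, fun n => ?_⟩
    rw [bandEval_single, bandEval_single, map_smul, intOp_dpow, add_assoc]

lemma exists_derOp_bandEval_succ (p : ℕ →₀ K[X]) :
    ∃ q : ℕ →₀ K[X], ∀ n, derOp K (bandEval (n + 1) p) = bandEval n q := by
  induction p using Finsupp.induction_linear with
  | zero => exact ⟨0, by simp⟩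
  | add f g hf hg =>
    obtain ⟨f', hf⟩ := hf
    obtain ⟨g', hg⟩ := hg
    exact ⟨f' + g', fun n => by simp [hf, hg]⟩
  | single k q =>
    refine ⟨Finsupp.single k (q.comp (X + 1)), fun n => ?_⟩
    rw [bandEval_single, bandEval_single, map_smul, add_right_comm, derOp_dpow_succ]
    simp

lemma exists_bandEval_add (p : ℕ →₀ K[X]) (m : ℕ) :
    ∃ q : ℕ →₀ K[X], ∀ n, bandEval (n + m) p = bandEval n q := by
  induction p using Finsupp.induction_linear with
  | zero => exact ⟨0, by simp⟩
  | add f g hf hg =>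
    obtain ⟨f', hf⟩ := hf
    obtain ⟨g', hg⟩ := hg
    exact ⟨f' + g', fun n => by simp [hf, hg]⟩
  | single k q =>
    refine ⟨Finsupp.single (m + k) (q.comp (X + C (m : K))), fun n => ?_⟩
    rw [bandEval_single, bandEval_single, add_assoc]
    simp

lemma IsEventuallyBand.add {b c : Module.End K K[X]} (hb : IsEventuallyBand b)
    (hc : IsEventuallyBand c) : IsEventuallyBand (b + c) := by
  obtain ⟨M, p, hp⟩ := hb
  obtain ⟨N, q, hq⟩ := hc
  obtain ⟨p', hp'⟩ := exists_bandEval_add p N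
  obtain ⟨q', hq'⟩ := exists_bandEval_add q M
  refine ⟨M + N, p' + q', fun n => ?_⟩
  rw [map_add, ← hp', ← hq', ← hp, ← hq, LinearMap.add_apply]
  congr 3 <;> ring

lemma isEventuallyBand_of_mem {a : Module.End K K[X]} (ha : a ∈ I1 K) : IsEventuallyBand a := by
  suffices h : ∀ b, IsEventuallyBand b → IsEventuallyBand (a * b) by
    rw [← mul_one a]
    exact h 1 ⟨0, Finsupp.single 0 1, fun n => by simp [bandEval_single]⟩
  induction ha using Algebra.adjoin_induction with
  | mem c hc =>
    rintro b ⟨M, p, hp⟩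
    rcases hc with rfl | rfl | rfl
    · obtain ⟨q, hq⟩ := exists_xOp_bandEval p
      exact ⟨M, q, fun n => by rw [Module.End.mul_apply, hp, hq]⟩
    · obtain ⟨q, hq⟩ := exists_derOp_bandEval_succ p
      exact ⟨M + 1, q, fun n => by rw [Module.End.mul_apply, ← hq, ← hp, add_right_comm,
        add_assoc]⟩
    · obtain ⟨q, hq⟩ := exists_intOp_bandEval p
      exact ⟨M, q, fun n => by rw [Module.End.mul_apply, hp, hq]⟩
  | algebraMap r =>
    rintro b ⟨M, p, hp⟩
    exact ⟨M, r • p, fun n => by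
      rw [Module.End.mul_apply, hp, map_smul, Module.algebraMap_end_apply]⟩
  | add c d _ _ hc hd => exact fun b hb => add_mul c d b ▸ (hc b hb).add (hd b hb)
  | mul c d _ _ hc hd => exact fun b hb => mul_assoc c d b ▸ hc _ (hd b hb)

/-- `T` raises the degree of every polynomial by `d`. -/
def RaisesDegree (T : Module.End K K[X]) (d : ℕ) : Prop := ∀ f, (T f).degree = f.degree + d

lemma RaisesDegree.injective {T : Module.End K K[X]} {d : ℕ} (hT : RaisesDegree T d) :
    Function.Injective T := by
  refine (injective_iff_map_eq_zero T).2 fun f hf => ?_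
  have h := hT f
  rw [hf, degree_zero, eq_comm, WithBot.add_eq_bot] at h
  exact degree_eq_bot.1 (h.resolve_right (WithBot.natCast_ne_bot d))

lemma exists_smul_dpow_degree_sub_lt {f : K[X]} {n : ℕ} (hf : f.degree = n) {g : K[X]}
    (hg : g.degree = n) : ∃ r : K, (f - r • g).degree < n := by
  have hg0 : g.leadingCoeff ≠ 0 := leadingCoeff_ne_zero.2 (by rintro rfl; simp at hg)
  have hf0 : f ≠ 0 := by rintro rfl; simp at hf
  have hr : f.leadingCoeff / g.leadingCoeff ≠ 0 := div_ne_zero (leadingCoeff_ne_zero.2 hf0) hg0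
  refine ⟨f.leadingCoeff / g.leadingCoeff, hf ▸ degree_sub_lt_left ?_ hf0 ?_⟩
  · rw [smul_eq_C_mul, degree_C_mul hr, hf, hg]
  · rw [smul_eq_C_mul, leadingCoeff_mul, leadingCoeff_C, div_mul_cancel₀ _ hg0]

lemma raisesDegree_of_dpow {T : Module.End K K[X]} {d : ℕ}
    (hT : ∀ n, (T (dpow K n)).degree = ((n + d : ℕ) : WithBot ℕ)) : RaisesDegree T d := by
  suffices h : ∀ n : ℕ, ∀ f : K[X], f.degree < n → (T f).degree = f.degree + d from
    fun f => h (f.natDegree + 1) f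
      (degree_le_natDegree.trans_lt (by exact_mod_cast f.natDegree.lt_succ_self))
  intro n
  induction n with
  | zero =>
    intro f hf
    obtain rfl : f = 0 := by simpa [Nat.WithBot.lt_zero_iff] using hf
    simp
  | succ n ih =>
    intro f hf
    rcases eq_or_ne f 0 with rfl | hf0
    · simp
    obtain ⟨r, hr⟩ := exists_smul_dpow_degree_sub_lt (degree_eq_natDegree hf0)
      (degree_dpow K f.natDegree)
    have hr0 : r ≠ 0 := by
      rintro rfl
      rw [zero_smul, sub_zero, degree_eq_natDegree hf0] at hr
      exact lt_irrefl _ hr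
    have hfn : f.natDegree ≤ n := Nat.lt_succ_iff.1 ((natDegree_lt_iff_degree_lt hf0).2 hf)
    have hlt := ih _ (hr.trans_le (by exact_mod_cast hfn))
    have hT' : (T (r • dpow K f.natDegree)).degree = ((f.natDegree + d : ℕ) : WithBot ℕ) := by
      rw [map_smul, smul_eq_C_mul, degree_C_mul hr0, hT]
    rw [← sub_add_cancel (T f) (T (r • dpow K f.natDegree)), ← map_sub,
      degree_add_eq_right_of_degree_lt, hT', degree_eq_natDegree hf0, Nat.cast_add]
    rw [hlt, hT', Nat.cast_add]
    exact WithBot.add_lt_add_right (WithBot.natCast_ne_bot d) hr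

lemma raisesDegree_intOp_pow (M : ℕ) : RaisesDegree (intOp K ^ M) M :=
  raisesDegree_of_dpow fun n => by rw [intOp_pow_dpow, degree_dpow]

lemma exists_forall_ge_eval_natCast_ne_zero {q : K[X]} (hq : q ≠ 0) :
    ∃ N : ℕ, ∀ n, q.eval ((n + N : ℕ) : K) ≠ 0 := by
  have hfin : {n : ℕ | q.eval (n : K) = 0}.Finite :=
    (finite_setOfPred_isRoot hq).preimage Nat.cast_injective.injOn
  obtain ⟨B, hB⟩ := hfin.bddAbove
  exact ⟨B + 1, fun n h => by have := hB h; omega⟩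

lemma degree_bandEval {p : ℕ →₀ K[X]} {d n : ℕ} (hd : ∀ k ∈ p.support, k ≤ d)
    (hn : (p d).eval (n : K) ≠ 0) : (bandEval n p).degree = ((n + d : ℕ) : WithBot ℕ) := by
  have h₁ : (bandEval n (p.erase d)).degree < ((n + d : ℕ) : WithBot ℕ) := by
    rw [← mem_degreeLT, bandEval, Finsupp.lsum_apply]
    refine Submodule.sum_mem _ fun k hk => ?_
    rw [Finsupp.support_erase, Finset.mem_erase] at hk
    refine Submodule.smul_mem _ _ (mem_degreeLT.2 ?_)
    rw [degree_dpow]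
    exact_mod_cast Nat.add_lt_add_left (lt_of_le_of_ne (hd k hk.2) hk.1) n
  have h₂ : (bandEval n (Finsupp.single d (p d))).degree = ((n + d : ℕ) : WithBot ℕ) := by
    rw [bandEval_single, smul_eq_C_mul, degree_C_mul hn, degree_dpow]
  rw [← Finsupp.erase_add_single d p, map_add, degree_add_eq_right_of_degree_lt (h₂ ▸ h₁), h₂]

lemma exists_mul_intOp_pow_eq_zero_or_raisesDegree {a : Module.End K K[X]} (ha : a ∈ I1 K) :
    ∃ M, a * intOp K ^ M = 0 ∨ ∃ d, RaisesDegree (a * intOp K ^ M) d := by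
  obtain ⟨M, p, hp⟩ := isEventuallyBand_of_mem ha
  rcases eq_or_ne p 0 with rfl | hp0
  · refine ⟨M, Or.inl (ext_dpow fun n => ?_)⟩
    rw [Module.End.mul_apply, intOp_pow_dpow, hp, map_zero, LinearMap.zero_apply]
  · have hs := Finsupp.support_nonempty_iff.2 hp0
    set d := p.support.max' hs
    obtain ⟨N, hN⟩ := exists_forall_ge_eval_natCast_ne_zero
      (Finsupp.mem_support_iff.1 (p.support.max'_mem hs))
    refine ⟨N + M, Or.inr ⟨N + d, raisesDegree_of_dpow fun n => ?_⟩⟩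
    rw [Module.End.mul_apply, intOp_pow_dpow, ← add_assoc, hp,
      degree_bandEval (fun k hk => p.support.le_max' k hk) (hN n), add_assoc]

/-- The first `M` coordinates of a polynomial with respect to the divided powers of `x`. -/
def lowCoeffs (M : ℕ) : K[X] →ₗ[K] (Fin M → K) :=
  LinearMap.pi fun j => (lcoeff K 0).comp (derOp K ^ (j : ℕ))

lemma intOp_pow_derOp_pow_apply_of_lowCoeffs_eq_zero {M : ℕ} {f : K[X]}
    (hf : lowCoeffs M f = 0) : (intOp K ^ M) ((derOp K ^ M) f) = f := by
  have h := LinearMap.congr_fun (sum_intOp_eOp_derOp K M) f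
  rw [LinearMap.sum_apply, Finset.sum_eq_zero, LinearMap.sub_apply] at h
  · exact (sub_eq_zero.1 h.symm).symm
  · intro j hj
    have hj' : ((derOp K ^ j) f).coeff 0 = 0 := congrFun hf ⟨j, Finset.mem_range.1 hj⟩
    rw [Module.End.mul_apply, Module.End.mul_apply, eOp_zero_apply, hj', C_0, map_zero]

lemma not_injective_of_finite {V : Type*} [AddCommGroup V] [Module K V] [Module.Finite K V]
    (φ : K[X] →ₗ[K] V) : ¬ Function.Injective φ :=
  fun h => Polynomial.not_finite (Module.Finite.of_injective φ h)

lemma exists_derOp_pow_mul_eq_zero {b : Module.End K K[X]} {L : ℕ} (hb : b * intOp K ^ L = 0) :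
    ∃ N, derOp K ^ N * b = 0 := by
  let N := (Finset.range L).sup (fun j => ((b * intOp K ^ j) 1).natDegree) + 1
  refine ⟨N, ?_⟩
  have h : b = ∑ j ∈ Finset.range L, b * (intOp K ^ j * eOp K 0 0 * derOp K ^ j) := by
    rw [← Finset.mul_sum, sum_intOp_eOp_derOp, mul_sub, ← mul_assoc, hb, zero_mul, mul_one,
      sub_zero]
  rw [h, Finset.mul_sum]
  refine Finset.sum_eq_zero fun j hj => LinearMap.ext fun f => ?_
  have hj' : ((b * intOp K ^ j) 1).natDegree < N :=
    Nat.lt_succ_of_le (Finset.le_sup (f := fun j => ((b * intOp K ^ j) 1).natDegree) hj)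
  have hz : (derOp K ^ N) (b ((intOp K ^ j) 1)) = 0 := by
    rw [Module.End.pow_apply]
    exact iterate_derivative_eq_zero hj'
  simp only [Module.End.mul_apply, eOp_zero_apply, LinearMap.zero_apply]
  rw [← mul_one (C _), ← smul_eq_C_mul, map_smul, map_smul, map_smul, hz, smul_zero]

lemma exists_mul_intOp_pow_eq_zero_of_lowCoeffs {b : Module.End K K[X]} (hb : b ∈ I1 K) {N : ℕ}
    (h : ∀ f, lowCoeffs N (b f) = 0 → b f = 0) : ∃ L, b * intOp K ^ L = 0 := by
  obtain ⟨L, hL | ⟨d, hL⟩⟩ := exists_mul_intOp_pow_eq_zero_or_raisesDegree hb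
  · exact ⟨L, hL⟩
  · refine (not_injective_of_finite ((lowCoeffs N).comp (b * intOp K ^ L)) ?_).elim
    refine (injective_iff_map_eq_zero _).2 fun f hf => ?_
    exact (injective_iff_map_eq_zero _).1 hL.injective f (h _ hf)

lemma exists_mul_intOp_pow_eq_zero_of_mul_eq_zero {b T : Module.End K K[X]} (hb : b ∈ I1 K)
    (hT : Function.Injective T) (h : b * T = 0) : ∃ L, b * intOp K ^ L = 0 := by
  obtain ⟨L, hL | ⟨d, hL⟩⟩ := exists_mul_intOp_pow_eq_zero_or_raisesDegree hb
  · exact ⟨L, hL⟩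
  · refine (not_injective_of_finite ((lowCoeffs L).comp T) ?_).elim
    refine (injective_iff_map_eq_zero _).2 fun f hf => ?_
    refine (injective_iff_map_eq_zero _).1 hT f ?_
    have hTf := intOp_pow_derOp_pow_apply_of_lowCoeffs_eq_zero hf
    have hb0 : (b * intOp K ^ L) ((derOp K ^ L) (T f)) = 0 := by
      rw [Module.End.mul_apply, hTf]
      exact LinearMap.congr_fun h f
    rw [← hTf, (injective_iff_map_eq_zero _).1 hL.injective _ hb0, map_zero]

lemma eq_zero_of_mul_raisesDegree_eq_zero {c T : Module.End K K[X]} {d : ℕ}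
    (hT : RaisesDegree T d) (hcT : c * T = 0) (h : ∀ i < d, c (dpow K i) = 0) : c = 0 := by
  refine ext_dpow fun n => ?_
  suffices h' : ∀ n : ℕ, ∀ f : K[X], f.degree < n → c f = 0 from
    h' (n + 1) _ (by rw [degree_dpow]; exact_mod_cast n.lt_succ_self)
  intro n
  induction n with
  | zero =>
    intro f hf
    obtain rfl : f = 0 := by simpa [Nat.WithBot.lt_zero_iff] using hf
    exact map_zero c
  | succ n ih =>
    intro f hf
    rcases eq_or_ne f 0 with rfl | hf0
    · exact map_zero c
    have hfn : f.natDegree ≤ n := Nat.lt_succ_iff.1 ((natDegree_lt_iff_degree_lt hf0).2 hf)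
    obtain ⟨g, hg, hcg⟩ : ∃ g : K[X], g.degree = f.natDegree ∧ c g = 0 := by
      rcases lt_or_ge f.natDegree d with hd | hd
      · exact ⟨dpow K f.natDegree, degree_dpow K _, h _ hd⟩
      · refine ⟨T (dpow K (f.natDegree - d)), ?_, LinearMap.congr_fun hcT _⟩
        rw [hT, degree_dpow, ← Nat.cast_add, Nat.sub_add_cancel hd]
    obtain ⟨r, hr⟩ := exists_smul_dpow_degree_sub_lt (degree_eq_natDegree hf0) hg
    have := ih _ (hr.trans_le (by exact_mod_cast hfn))
    rwa [map_sub, map_smul, hcg, smul_zero, sub_zero] at this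

lemma fg_of_le_span_insert {R M : Type*} [Ring R] [AddCommGroup M] [Module R M] [Module K M]
    [SMul K R] [IsScalarTower K R M] {I : Submodule R M} (W : Submodule K M) [Module.Finite K W]
    (hW : ∀ w ∈ W, w ∈ I) {t : M} (ht : t ∈ I)
    (h : ∀ b ∈ I, b ∈ Submodule.span R (insert t (W : Set M))) : I.FG := by
  classical
  obtain ⟨s, hs⟩ := (Module.Finite.iff_fg.1 ‹_› : W.FG)
  have hWs : (W : Set M) ⊆ Submodule.span R (s : Set M) := by
    rw [← hs]
    exact Submodule.span_subset_span K R _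
  refine ⟨insert t s, le_antisymm (Submodule.span_le.2 ?_) fun b hb => ?_⟩
  · rw [Finset.coe_insert, Set.insert_subset_iff]
    exact ⟨ht, fun w hw => hW w (hs ▸ Submodule.subset_span hw)⟩
  · refine Submodule.span_le.2 ?_ (h b hb)
    rw [Finset.coe_insert, Set.insert_subset_iff]
    exact ⟨Submodule.subset_span (Set.mem_insert _ _),
      hWs.trans (Submodule.span_mono (Set.subset_insert _ _))⟩

section KernelsOfMultiplication

variable {R : Type*} [Ring R] [Algebra K R] {ρ : R →ₐ[K] Module.End K K[X]}

lemma ker_lmulMap_fg (hρ : Function.Injective ρ) (hρI : ρ.range = I1 K) {a s t : R} {N : ℕ}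
    (hat : a * t = 0) (hst : s * t * s = s)
    (h : ∀ f, ρ a f = 0 → ρ s f = 0 → lowCoeffs N f = 0 → f = 0) :
    (LinearMap.ker (lmulMap R a)).FG := by
  obtain ⟨E, hE⟩ : eOp K 0 0 ∈ ρ.range := hρI ▸ eOp_mem K 0 0
  obtain ⟨D, hD⟩ : derOp K ∈ ρ.range := hρI ▸ derOp_mem K
  obtain ⟨J, hJ⟩ : intOp K ∈ ρ.range := hρI ▸ intOp_mem K
  replace hE : ρ E = eOp K 0 0 := hE
  replace hD : ρ D = derOp K := hD
  replace hJ : ρ J = intOp K := hJ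
  let W : Submodule K R := LinearMap.ker (LinearMap.mulRight K (1 - E)) ⊓
    (LinearMap.ker (LinearMap.mulLeft K a) ⊓ LinearMap.ker (LinearMap.mulLeft K s))
  have hWmem : ∀ c : R, c ∈ W ↔ c * (1 - E) = 0 ∧ a * c = 0 ∧ s * c = 0 :=
    fun c => Iff.rfl
  have hker : ∀ b : R, a * b = 0 → s * b = 0 → ∀ f, lowCoeffs N (ρ b f) = 0 → ρ b f = 0 :=
    fun b hab hsb f hf => h _
      (by rw [← Module.End.mul_apply, ← map_mul, hab, map_zero, LinearMap.zero_apply])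
      (by rw [← Module.End.mul_apply, ← map_mul, hsb, map_zero, LinearMap.zero_apply]) hf
  let φ : W →ₗ[K] (Fin N → K) :=
    (lowCoeffs N).comp ((LinearMap.applyₗ (1 : K[X])).comp (ρ.toLinearMap.comp W.subtype))
  have hφ : Function.Injective φ := by
    refine (injective_iff_map_eq_zero φ).2 fun c hc => ?_
    obtain ⟨hce, hac, hsc⟩ := (hWmem c.1).1 c.2
    have hc1 : ρ c.1 1 = 0 := hker c.1 hac hsc 1 hc
    refine Subtype.ext ((injective_iff_map_eq_zero ρ).1 hρ _ (LinearMap.ext fun f => ?_))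
    have hcf : ρ (c.1 * (1 - E)) f = 0 := by rw [hce, map_zero, LinearMap.zero_apply]
    rw [map_mul, map_sub, map_one, hE, Module.End.mul_apply, LinearMap.sub_apply,
      Module.End.one_apply, eOp_zero_apply, ← mul_one (C _), ← smul_eq_C_mul, map_sub, map_smul,
      hc1, smul_zero, sub_zero] at hcf
    exact hcf
  have : Module.Finite K W := Module.Finite.of_injective φ hφ
  have htI : t ∈ LinearMap.ker (lmulMap R a) := hat
  refine fg_of_le_span_insert W (fun w hw => ((hWmem w).1 hw).2.1) htI fun b hb => ?_
  have hab : a * b = 0 := hb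
  obtain ⟨b', hb'⟩ : ∃ b', b' = b - t * (s * b) := ⟨_, rfl⟩
  have hab' : a * b' = 0 := by
    rw [hb', mul_sub, hab, ← mul_assoc, hat, zero_mul, sub_zero]
  have hsb' : s * b' = 0 := by
    rw [hb', mul_sub, ← mul_assoc, ← mul_assoc, hst, sub_self]
  obtain ⟨L, hL⟩ :=
    exists_mul_intOp_pow_eq_zero_of_lowCoeffs (hρI ▸ ⟨b', rfl⟩ : ρ b' ∈ I1 K) (hker b' hab' hsb')
  have hsum : b' = ∑ j ∈ Finset.range L, b' * J ^ j * E * D ^ j := by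
    refine hρ ?_
    simp only [map_sum, map_mul, map_pow, hE, hD, hJ, mul_assoc]
    simp only [← mul_assoc (intOp K ^ _)]
    rw [← Finset.mul_sum, sum_intOp_eOp_derOp, mul_sub, ← mul_assoc, hL, zero_mul, mul_one,
      sub_zero]
  have hbt : b = MulOpposite.op (s * b) • t + b' := by
    rw [hb', op_smul_eq_mul, add_sub_cancel]
  rw [hbt]
  refine add_mem (Submodule.smul_mem _ _ (Submodule.subset_span (Set.mem_insert _ _))) ?_
  rw [hsum]
  refine Submodule.sum_mem _ fun j _ => ?_
  rw [← op_smul_eq_mul (D ^ j)]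
  refine Submodule.smul_mem _ _ (Submodule.subset_span (Set.mem_insert_of_mem _ ?_))
  refine (hWmem _).2 ⟨?_, ?_, ?_⟩
  · have he : E * (1 - E) = 0 := by
      refine hρ (LinearMap.ext fun f => ?_)
      simp [hE, eOp_zero_apply]
    rw [mul_assoc, he, mul_zero]
  · rw [← mul_assoc, ← mul_assoc, hab', zero_mul, zero_mul]
  · rw [← mul_assoc, ← mul_assoc, hsb', zero_mul, zero_mul]

lemma ker_rmulMap_fg (hρ : Function.Injective ρ) (hρI : ρ.range = I1 K) {a s t : R}
    {T : Module.End K K[X]} {d : ℕ} (hta : t * a = 0) (hst : s * t * s = s)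
    (hT : RaisesDegree T d) (h : ∀ c : R, c * a = 0 → c * s = 0 → ρ c * T = 0) :
    (LinearMap.ker (rmulMap R a)).FG := by
  obtain ⟨E, hE⟩ : eOp K 0 0 ∈ ρ.range := hρI ▸ eOp_mem K 0 0
  obtain ⟨D, hD⟩ : derOp K ∈ ρ.range := hρI ▸ derOp_mem K
  obtain ⟨J, hJ⟩ : intOp K ∈ ρ.range := hρI ▸ intOp_mem K
  replace hE : ρ E = eOp K 0 0 := hE
  replace hD : ρ D = derOp K := hD
  replace hJ : ρ J = intOp K := hJ
  let W : Submodule K R := LinearMap.ker (LinearMap.mulLeft K (1 - E)) ⊓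
    (LinearMap.ker (LinearMap.mulRight K a) ⊓ LinearMap.ker (LinearMap.mulRight K s))
  have hWmem : ∀ c : R, c ∈ W ↔ (1 - E) * c = 0 ∧ c * a = 0 ∧ c * s = 0 :=
    fun c => Iff.rfl
  let φ : W →ₗ[K] (Fin d → K) := LinearMap.pi fun i =>
    (lcoeff K 0).comp ((LinearMap.applyₗ (dpow K i)).comp (ρ.toLinearMap.comp W.subtype))
  have hφ : Function.Injective φ := by
    refine (injective_iff_map_eq_zero φ).2 fun c hc => ?_
    obtain ⟨hec, hca, hcs⟩ := (hWmem c.1).1 c.2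
    refine Subtype.ext ((injective_iff_map_eq_zero ρ).1 hρ _
      (eq_zero_of_mul_raisesDegree_eq_zero hT (h c.1 hca hcs) fun i hi => ?_))
    have hi0 : (ρ c.1 (dpow K i)).coeff 0 = 0 := congrFun hc ⟨i, hi⟩
    have hcf : ρ ((1 - E) * c.1) (dpow K i) = 0 := by rw [hec, map_zero, LinearMap.zero_apply]
    rwa [map_mul, map_sub, map_one, hE, Module.End.mul_apply, LinearMap.sub_apply,
      Module.End.one_apply, eOp_zero_apply, hi0, C_0, sub_zero] at hcf
  have : Module.Finite K W := Module.Finite.of_injective φ hφ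
  have htI : t ∈ LinearMap.ker (rmulMap R a) := hta
  refine fg_of_le_span_insert W (fun w hw => ((hWmem w).1 hw).2.1) htI fun b hb => ?_
  have hba : b * a = 0 := hb
  obtain ⟨b', hb'⟩ : ∃ b', b' = b - b * s * t := ⟨_, rfl⟩
  have hba' : b' * a = 0 := by
    rw [hb', sub_mul, hba, mul_assoc, hta, mul_zero, sub_zero]
  have hbs' : b' * s = 0 := by
    rw [hb', sub_mul, mul_assoc, mul_assoc, ← mul_assoc s, hst, sub_self]
  obtain ⟨L, hL⟩ := exists_mul_intOp_pow_eq_zero_of_mul_eq_zero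
    (hρI ▸ ⟨b', rfl⟩ : ρ b' ∈ I1 K) hT.injective (h b' hba' hbs')
  obtain ⟨N, hN⟩ := exists_derOp_pow_mul_eq_zero hL
  have hsum : b' = ∑ i ∈ Finset.range N, J ^ i * (E * (D ^ i * b')) := by
    refine hρ ?_
    simp only [map_sum, map_mul, map_pow, hE, hD, hJ, ← mul_assoc]
    rw [← Finset.sum_mul, sum_intOp_eOp_derOp, sub_mul, mul_assoc, hN, mul_zero, one_mul,
      sub_zero]
  have hbt : b = (b * s) • t + b' := by
    rw [hb', smul_eq_mul, add_sub_cancel]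
  rw [hbt]
  refine add_mem (Submodule.smul_mem _ _ (Submodule.subset_span (Set.mem_insert _ _))) ?_
  rw [hsum]
  refine Submodule.sum_mem _ fun i _ => ?_
  rw [← smul_eq_mul (J ^ i)]
  refine Submodule.smul_mem _ _ (Submodule.subset_span (Set.mem_insert_of_mem _ ?_))
  refine (hWmem _).2 ⟨?_, ?_, ?_⟩
  · have he : (1 - E) * E = 0 := by
      refine hρ (LinearMap.ext fun f => ?_)
      simp [hE, eOp_zero_apply]
    rw [← mul_assoc, he, zero_mul]
  · rw [mul_assoc, mul_assoc, hba', mul_zero, mul_zero]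
  · rw [mul_assoc, mul_assoc, hbs', mul_zero, mul_zero]

end KernelsOfMultiplication

lemma derI_pow_mul_intI_pow (M : ℕ) : derI K ^ M * intI K ^ M = 1 :=
  Subtype.ext (derOp_pow_mul_intOp_pow K M)

variable (K)

/-- for every `a ∈ I₁`, the left modules `ker(·a)` and `I₁/I₁a` are finitely
generated, and the right modules `ker(a·)` and `I₁/aI₁` are finitely generated. -/
theorem statement6 (a : I1 K) :
    (LinearMap.ker (rmulMap (I1 K) a)).FG
    ∧ Module.Finite (I1 K) (Coker (I1 K) (rmulMap (I1 K) a))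
    ∧ (LinearMap.ker (lmulMap (I1 K) a)).FG
    ∧ Module.Finite ((I1 K)ᵐᵒᵖ) (CokerOp (I1 K) (lmulMap (I1 K) a)) := by
  have hinj : Function.Injective (I1 K).val := Subtype.val_injective
  have hrange : (I1 K).val.range = I1 K := (I1 K).range_val
  refine ⟨?_, Module.Finite.quotient _ _, ?_, ?_⟩
  · obtain ⟨M, hM | ⟨d, hM⟩⟩ := exists_mul_intOp_pow_eq_zero_or_raisesDegree a.2
    · obtain ⟨L, hL⟩ := exists_derOp_pow_mul_eq_zero hM
      refine ker_rmulMap_fg hinj hrange (s := intI K ^ L) (t := derI K ^ L) (Subtype.ext hL) ?_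
        (raisesDegree_intOp_pow L) fun c _ hc => congrArg Subtype.val hc
      rw [mul_assoc, derI_pow_mul_intI_pow, mul_one]
    · refine ker_rmulMap_fg hinj hrange (s := 0) (t := 0) (zero_mul a) (mul_zero _) hM
        fun c hc _ => ?_
      rw [← mul_assoc]
      exact (congrArg (· * intOp K ^ M) (congrArg Subtype.val hc)).trans (zero_mul _)
  · obtain ⟨M, hM | ⟨d, hM⟩⟩ := exists_mul_intOp_pow_eq_zero_or_raisesDegree a.2
    · refine ker_lmulMap_fg hinj hrange (s := derI K ^ M) (t := intI K ^ M) (N := M)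
        (Subtype.ext hM) ?_
        fun f _ hs hf => ?_
      · rw [derI_pow_mul_intI_pow, one_mul]
      · have hs' : (derOp K ^ M) f = 0 := hs
        rw [← intOp_pow_derOp_pow_apply_of_lowCoeffs_eq_zero hf, hs', map_zero]
    · refine ker_lmulMap_fg hinj hrange (s := 0) (t := 0) (N := M) (mul_zero a) (mul_zero _)
        fun f ha _ hf => ?_
      have hJf := intOp_pow_derOp_pow_apply_of_lowCoeffs_eq_zero hf
      have h0 : (a.1 * intOp K ^ M) ((derOp K ^ M) f) = 0 := by
        rw [Module.End.mul_apply, hJf]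
        exact ha
      rw [← hJf, (injective_iff_map_eq_zero _).1 hM.injective _ h0, map_zero]
  · have : Module.Finite (I1 K)ᵐᵒᵖ (I1 K) :=
      ⟨⟨{1}, Submodule.eq_top_iff'.2 fun b => by
        simpa using Submodule.smul_mem (Submodule.span (I1 K)ᵐᵒᵖ {(1 : I1 K)})
          (MulOpposite.op b) (Submodule.mem_span_singleton_self 1)⟩⟩
    exact Module.Finite.quotient _ _

end
end

section
/- The intersection of two finitely generated left ideals of the algebra I₁ is a finitely generated left ideal of I₁, and the intersection of two finitely generated right ideals of I₁ is a finitely generated right ideal of I₁. -/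
open Polynomial

noncomputable section
set_option synthInstance.maxHeartbeats 1000000
set_option maxHeartbeats 1000000
set_option linter.unusedSectionVars false

variable (K : Type*) [Field K] [CharZero K]

section DegreeRaising

variable {S : Type*} [CommRing S]

/-- An additive self-map of `S[X]` raising degrees by at most one and turning the coefficient of
degree `n` of a polynomial of degree at most `n` into the coefficient of degree `n + 1`. -/
structure DegreeRaising (T : S[X] →+ S[X]) : Prop where
  mem_degreeLT : ∀ n, ∀ P ∈ degreeLT S n, T P ∈ degreeLT S (n + 1)
  coeff_succ : ∀ n, ∀ P ∈ degreeLT S (n + 1), (T P).coeff (n + 1) = P.coeff n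

lemma DegreeRaising.iterate {T : S[X] →+ S[X]} (hT : DegreeRaising T) {n : ℕ} {P : S[X]}
    (hP : P ∈ degreeLT S (n + 1)) (j : ℕ) :
    T^[j] P ∈ degreeLT S (n + j + 1) ∧ (T^[j] P).coeff (n + j) = P.coeff n := by
  induction j with
  | zero => exact ⟨hP, rfl⟩
  | succ j ih =>
    rw [Function.iterate_succ_apply']
    exact ⟨hT.mem_degreeLT _ _ ih.1, (hT.coeff_succ _ _ ih.1).trans ih.2⟩

lemma mem_degreeLT_of_coeff_eq_zero {n : ℕ} {P : S[X]} (hP : P ∈ degreeLT S (n + 1))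
    (h : P.coeff n = 0) : P ∈ degreeLT S n := by
  rw [mem_degreeLT, degree_lt_iff_coeff_zero] at *
  intro m hm
  rcases hm.eq_or_lt with rfl | hm
  · exact h
  · exact hP m hm

lemma self_mem_degreeLT (P : S[X]) : P ∈ degreeLT S (P.natDegree + 1) :=
  mem_degreeLT.2 (degree_lt_iff_coeff_zero _ _ |>.2 fun _ hm => coeff_eq_zero_of_natDegree_lt hm)

lemma iterate_mem {T : S[X] →+ S[X]} {M : Submodule S S[X]} (hM : ∀ P ∈ M, T P ∈ M)
    {P : S[X]} (hP : P ∈ M) (j : ℕ) : T^[j] P ∈ M := by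
  induction j with
  | zero => exact hP
  | succ j ih => exact Function.iterate_succ_apply' T j P ▸ hM _ ih

/-- A Hilbert basis theorem: over a Noetherian ring, a submodule of `S[X]` stable under a
degree-raising map is generated, as a stable submodule, by finitely many elements. -/
theorem DegreeRaising.exists_finset [IsNoetherianRing S] {T : S[X] →+ S[X]}
    (hT : DegreeRaising T) (M : Submodule S S[X]) (hM : ∀ P ∈ M, T P ∈ M) :
    ∃ s : Finset S[X], (s : Set S[X]) ⊆ M ∧
      ∀ M' : Submodule S S[X], (∀ P ∈ M', T P ∈ M') → (s : Set S[X]) ⊆ M' → M ≤ M' := by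
  let lc : ℕ → Submodule S S := fun n => (M ⊓ degreeLT S (n + 1)).map (lcoeff S n)
  have hlc : Monotone lc := by
    refine monotone_nat_of_le_succ fun n => ?_
    rintro _ ⟨P, ⟨hPM, hP⟩, rfl⟩
    exact ⟨T P, ⟨hM P hPM, hT.mem_degreeLT _ _ hP⟩, hT.coeff_succ n P hP⟩
  obtain ⟨N, hN⟩ := monotone_stabilizes_iff_noetherian.2 ‹IsNoetherianRing S› ⟨lc, hlc⟩
  have hnoeth : IsNoetherian S (degreeLT S (N + 1)) :=
    isNoetherian_of_linearEquiv (degreeLTEquiv S (N + 1)).symm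
  obtain ⟨s, hs⟩ := isNoetherian_submodule_right.1 hnoeth M
  refine ⟨s, fun P hP => ((hs ▸ Submodule.subset_span hP : P ∈ M ⊓ _)).1, fun M' hM' hsM' => ?_⟩
  have hlow : M ⊓ degreeLT S (N + 1) ≤ M' := hs ▸ Submodule.span_le.2 hsM'
  have key : ∀ n, M ⊓ degreeLT S (N + 1 + n) ≤ M' := by
    intro n
    induction n with
    | zero => exact hlow
    | succ n ih =>
      rintro P ⟨hPM, hP⟩
      have hmem : P.coeff (N + 1 + n) ∈ lc N := by
        have h := hN (N + 1 + n) (by omega)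
        simp only [OrderHom.coe_mk] at h
        exact h ▸ ⟨P, ⟨hPM, hP⟩, rfl⟩
      obtain ⟨Q, ⟨hQM, hQ⟩, hQc⟩ := hmem
      obtain ⟨hQ1, hQ2⟩ := hT.iterate hQ (1 + n)
      rw [← add_assoc] at hQ1 hQ2
      have hdiff : P - T^[1 + n] Q ∈ M' := by
        refine ih ⟨sub_mem hPM (iterate_mem hM hQM _), ?_⟩
        refine mem_degreeLT_of_coeff_eq_zero (sub_mem hP hQ1) ?_
        rw [coeff_sub, hQ2, ← hQc, lcoeff_apply, sub_self]
      simpa using add_mem hdiff (iterate_mem hM' (hlow ⟨hQM, hQ⟩) (1 + n))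
  intro P hP
  refine key P.natDegree ⟨hP, ?_⟩
  exact degreeLT_mono (by omega) (self_mem_degreeLT P)

/-- The map `∑ uⱼ Xʲ ↦ ∑ uⱼ Tʲ(P)`. -/
def evalAt (T : S[X] →+ S[X]) (P : S[X]) : S[X] →ₗ[S] S[X] :=
  lsum fun j => LinearMap.toSpanSingleton S S[X] (T^[j] P)

lemma evalAt_apply (T : S[X] →+ S[X]) (P U : S[X]) :
    evalAt T P U = ∑ j ∈ Finset.range (U.natDegree + 1), U.coeff j • T^[j] P := by
  simp [evalAt, lsum, sum_over_range]

lemma DegreeRaising.evalAt_mem_degreeLT {T : S[X] →+ S[X]} (hT : DegreeRaising T) {P U : S[X]}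
    {m n : ℕ} (hP : P ∈ degreeLT S (n + 1)) (hU : U ∈ degreeLT S m) :
    evalAt T P U ∈ degreeLT S (n + m) := by
  rw [evalAt_apply]
  refine sum_mem fun j _ => ?_
  by_cases hj : j < m
  · exact Submodule.smul_mem _ _ (degreeLT_mono (by omega) (hT.iterate hP j).1)
  · rw [Polynomial.mem_degreeLT, degree_lt_iff_coeff_zero] at hU
    simp [hU j (not_lt.1 hj)]

lemma DegreeRaising.evalAt_ne_zero [IsDomain S] {T : S[X] →+ S[X]} (hT : DegreeRaising T)
    {P U : S[X]} (hP : P ≠ 0) (hU : U ≠ 0) : evalAt T P U ≠ 0 := by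
  intro h
  have hc : (evalAt T P U).coeff (P.natDegree + U.natDegree)
      = U.leadingCoeff * P.leadingCoeff := by
    rw [evalAt_apply, finsetSum_coeff, Finset.sum_range_succ, Finset.sum_eq_zero, zero_add,
      coeff_smul, (hT.iterate (self_mem_degreeLT P) _).2]
    · rfl
    · intro j hj
      have h1 := (hT.iterate (self_mem_degreeLT P) j).1
      rw [Polynomial.mem_degreeLT, degree_lt_iff_coeff_zero] at h1
      rw [coeff_smul, h1 _ (by have := Finset.mem_range.1 hj; omega), smul_zero]
  rw [h, coeff_zero] at hc
  exact mul_ne_zero (leadingCoeff_ne_zero.2 hU) (leadingCoeff_ne_zero.2 hP) hc.symm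

/-- An Ore condition for the twisted multiplication `evalAt`. -/
theorem DegreeRaising.exists_evalAt_eq [IsDomain S] {T : S[X] →+ S[X]} (hT : DegreeRaising T)
    {P Q : S[X]} (hP : P ≠ 0) (hQ : Q ≠ 0) :
    ∃ U V : S[X], evalAt T P U = evalAt T Q V ∧ evalAt T P U ≠ 0 := by
  set c := max P.natDegree Q.natDegree
  let f : (degreeLT S (c + 1) × degreeLT S (c + 1)) →ₗ[S] degreeLT S (c + (c + 1)) :=
    LinearMap.codRestrict _
      ((evalAt T P ∘ₗ (degreeLT S (c + 1)).subtype).coprod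
        (-(evalAt T Q ∘ₗ (degreeLT S (c + 1)).subtype)))
      (by
        rintro ⟨U, V⟩
        refine add_mem (hT.evalAt_mem_degreeLT ?_ U.2) (neg_mem (hT.evalAt_mem_degreeLT ?_ V.2))
        · exact degreeLT_mono (by omega) (self_mem_degreeLT P)
        · exact degreeLT_mono (by omega) (self_mem_degreeLT Q))
  have hf : ¬ Function.Injective f := by
    intro hf
    have e1 := degreeLTEquiv S (c + 1)
    have e2 := degreeLTEquiv S (c + (c + 1))
    have : Module.Finite S (degreeLT S (c + (c + 1))) := Module.Finite.equiv e2.symm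
    have : Module.Finite S (degreeLT S (c + 1)) := Module.Finite.equiv e1.symm
    have : Module.Free S (degreeLT S (c + 1)) := Module.Free.of_equiv e1.symm
    have h := LinearMap.finrank_le_finrank_of_injective hf
    rw [Module.finrank_prod, e1.finrank_eq, e2.finrank_eq] at h
    simp at h
  rw [← LinearMap.ker_eq_bot, Submodule.eq_bot_iff] at hf
  push Not at hf
  obtain ⟨⟨U, V⟩, hUV, hne⟩ := hf
  have heq : evalAt T P U = evalAt T Q V := by
    have := congrArg Subtype.val (LinearMap.mem_ker.1 hUV)
    simpa [f, ← sub_eq_add_neg, sub_eq_zero] using this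
  refine ⟨U, V, heq, ?_⟩
  by_cases hU : (U : S[X]) = 0
  · have hV : (V : S[X]) ≠ 0 := fun hV => hne (by ext1 <;> exact Subtype.ext ‹_›)
    exact heq ▸ hT.evalAt_ne_zero hQ hV
  · exact hT.evalAt_ne_zero hP hU

end DegreeRaising

section Twist

variable (k : Type*) [Field k]

/-- The map `P ↦ P h - Y ∂P/∂Y` on `k[Y][h]`: left multiplication by `h` on the normal forms
`∑ cᵢⱼ pⁱ hʲ` when `h p = p (h - 1)`. -/
def twist : k[X][X] →+ k[X][X] :=
  (lsum (R := k) fun j => (monomial (R := k[X]) (j + 1)).restrictScalars k -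
    (monomial (R := k[X]) j).restrictScalars k ∘ₗ LinearMap.mulLeft k X ∘ₗ
      derivative).toAddMonoidHom

lemma twist_monomial (j : ℕ) (g : k[X]) :
    twist k (monomial j g) = monomial (j + 1) g - monomial j (X * derivative g) := by
  simp [twist, lsum]

lemma coeff_succ_twist (P : k[X][X]) (n : ℕ) :
    (twist k P).coeff (n + 1) = P.coeff n - X * derivative (P.coeff (n + 1)) := by
  induction P using Polynomial.induction_on' with
  | add P Q hP hQ => simp only [map_add, coeff_add, hP, hQ]; ring
  | monomial j g =>
    rw [twist_monomial]
    simp only [coeff_sub, coeff_monomial, add_left_inj]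
    split_ifs <;> simp

lemma degreeRaising_twist : DegreeRaising (twist k) where
  mem_degreeLT n P hP := by
    rw [mem_degreeLT, degree_lt_iff_coeff_zero] at *
    rintro (_ | m) hm
    · omega
    · rw [coeff_succ_twist, hP m (by omega), hP (m + 1) (by omega)]
      simp
  coeff_succ n P hP := by
    rw [mem_degreeLT, degree_lt_iff_coeff_zero] at hP
    rw [coeff_succ_twist, hP (n + 1) le_rfl]
    simp

end Twist

/-- Elements `p`, `q`, `h` generating an algebra and satisfying the relations of `∂`, `∫`, `H`
in `I₁`. -/
structure IntegroDifferential (k : Type*) [Field k] {R : Type*} [Ring R] [Algebra k R]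
    (p q h : R) : Prop where
  p_mul_q : p * q = 1
  p_mul_h : p * h = (h + 1) * p
  h_mul_q : h * q = q * (h + 1)
  h_mul_e : h * (1 - q * p) = 1 - q * p
  e_mul_h : (1 - q * p) * h = 1 - q * p
  adjoin_eq_top : Algebra.adjoin k {p, q, h} = ⊤

section NormalForm

variable (k : Type*) [Field k] {R : Type*} [Ring R] [Algebra k R] (p q h : R)

/-- The evaluation `∑ cᵢⱼ Yⁱ Xʲ ↦ ∑ cᵢⱼ pⁱ hʲ`. -/
def normalForm : k[X][X] →ₗ[k] R :=
  lsum fun j => LinearMap.mulRight k (h ^ j) ∘ₗ (aeval p).toLinearMap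

lemma normalForm_monomial (j : ℕ) (g : k[X]) :
    normalForm k p h (monomial j g) = aeval p g * h ^ j := by
  simp [normalForm, lsum]

lemma normalForm_smul (g : k[X]) (P : k[X][X]) :
    normalForm k p h (g • P) = aeval p g * normalForm k p h P := by
  induction P using Polynomial.induction_on' with
  | add P Q hP hQ => rw [smul_add, map_add, map_add, hP, hQ, mul_add]
  | monomial j f =>
    rw [smul_monomial, normalForm_monomial, normalForm_monomial, smul_eq_mul, map_mul, mul_assoc]

/-- The left ideal of compact operators, generated by the elements `e pʲ` with `e = 1 - q p`. -/
def compactIdeal : Ideal R := Ideal.span (Set.range fun j : ℕ => (1 - q * p) * p ^ j)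

/-- The part of the left ideal of compact operators generated by the `e pʲ` with `j < n`. -/
def compactIdealLT (n : ℕ) : Ideal R :=
  ⨆ j : Fin n, Ideal.span {(1 - q * p) * p ^ (j : ℕ)}

variable {k p q h}

lemma mem_compactIdealLT {j n : ℕ} (hj : j < n) :
    (1 - q * p) * p ^ j ∈ compactIdealLT p q n :=
  Submodule.mem_iSup_of_mem (⟨j, hj⟩ : Fin n) (Submodule.mem_span_singleton_self _)

lemma exists_le_compactIdealLT {L : Ideal R} (hL : L.FG) (hLF : L ≤ compactIdeal p q) :
    ∃ n, L ≤ compactIdealLT p q n := by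
  rw [compactIdeal, Ideal.span, Submodule.span_range_eq_iSup] at hLF
  obtain ⟨s, hs⟩ := CompleteLattice.IsCompactElement.exists_finset_of_le_iSup _
    ((Submodule.fg_iff_compact L).1 hL) _ hLF
  refine ⟨s.sup id + 1, hs.trans (iSup₂_le fun j hj => ?_)⟩
  refine (Submodule.span_singleton_le_iff_mem _ _).2 (mem_compactIdealLT ?_)
  exact Nat.lt_succ_of_le (Finset.le_sup (f := id) hj)

lemma normalForm_eq_sum (P : k[X][X]) :
    normalForm k p h P =
      (Bivariate.swap (R := k) P).sum fun i f => p ^ i * aeval h f := by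
  have hadd (U V : k[X][X]) : (U + V).sum (fun i f => p ^ i * aeval h f)
      = U.sum (fun i f => p ^ i * aeval h f) + V.sum fun i f => p ^ i * aeval h f :=
    sum_add_index _ _ _ (by simp) (by simp [mul_add])
  induction P using Polynomial.induction_on' with
  | add P Q hP hQ => rw [map_add, map_add, hadd, hP, hQ]
  | monomial j g =>
    induction g using Polynomial.induction_on' with
    | add f g hf hg => rw [map_add, map_add, map_add, hadd, hf, hg]
    | monomial i c =>
      rw [normalForm_monomial, Bivariate.swap_monomial_monomial, sum_monomial_index _ _ (by simp)]
      rw [aeval_monomial, aeval_monomial, ← mul_assoc, Algebra.commutes]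

namespace IntegroDifferential

variable (H : IntegroDifferential k p q h)
include H

lemma induction {C : R → Prop} (hp : C p) (hq : C q) (hh : C h)
    (algebraMap : ∀ c : k, C (algebraMap k R c)) (add : ∀ a b, C a → C b → C (a + b))
    (mul : ∀ a b, C a → C b → C (a * b)) (r : R) : C r := by
  have hr : r ∈ Algebra.adjoin k {p, q, h} := H.adjoin_eq_top ▸ Algebra.mem_top
  induction hr using Algebra.adjoin_induction with
  | mem x hx => rcases hx with rfl | rfl | rfl <;> assumption
  | algebraMap c => exact algebraMap c
  | add a b _ _ ha hb => exact add a b ha hb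
  | mul a b _ _ ha hb => exact mul a b ha hb

lemma p_mul_e : p * (1 - q * p) = 0 := by
  rw [mul_sub, ← mul_assoc, H.p_mul_q]; simp

lemma e_mul_q : (1 - q * p) * q = 0 := by
  rw [sub_mul, mul_assoc, H.p_mul_q]; simp

lemma p_pow_mul_h (n : ℕ) : p ^ n * h = (h + n) * p ^ n := by
  induction n with
  | zero => simp
  | succ n ih =>
    rw [pow_succ', mul_assoc, ih, ← mul_assoc, mul_add, H.p_mul_h, ← Nat.cast_comm, ← add_mul,
      mul_assoc, Nat.cast_succ]
    congr 1
    abel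

lemma h_mul_q_pow (n : ℕ) : h * q ^ n = q ^ n * (h + n) := by
  induction n with
  | zero => simp
  | succ n ih =>
    rw [pow_succ, ← mul_assoc, ih, mul_assoc, add_mul, H.h_mul_q, Nat.cast_comm, ← mul_add,
      ← mul_assoc, Nat.cast_succ]
    congr 1
    abel

lemma p_pow_mul_q_pow (n m : ℕ) : p ^ (n + m) * q ^ n = p ^ m := by
  induction n with
  | zero => simp
  | succ n ih =>
    rw [add_right_comm, pow_succ, pow_succ', mul_assoc, ← mul_assoc p, H.p_mul_q, one_mul, ih]

lemma e_mul_p_pow_mul_h (m : ℕ) :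
    (1 - q * p) * p ^ m * h = ((m : k) + 1) • ((1 - q * p) * p ^ m) := by
  rw [mul_assoc, H.p_pow_mul_h, ← mul_assoc, mul_add, H.e_mul_h, ← Nat.cast_comm, add_mul,
    mul_assoc (m : R), add_smul, one_smul, add_comm, Nat.cast_smul_eq_nsmul, nsmul_eq_mul]

lemma e_mul_p_pow_mul_aeval (m : ℕ) (f : k[X]) :
    (1 - q * p) * p ^ m * aeval h f = f.eval ((m : k) + 1) • ((1 - q * p) * p ^ m) := by
  induction f using Polynomial.induction_on' with
  | add f g hf hg => rw [map_add, mul_add, hf, hg, eval_add, add_smul]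
  | monomial n c =>
    have hpow : (1 - q * p) * p ^ m * h ^ n = ((m : k) + 1) ^ n • ((1 - q * p) * p ^ m) := by
      induction n with
      | zero => simp
      | succ n ih =>
        rw [pow_succ, ← mul_assoc, ih, smul_mul_assoc, H.e_mul_p_pow_mul_h, smul_smul, pow_succ]
    rw [aeval_monomial, eval_monomial, ← mul_assoc, ← Algebra.commutes, mul_assoc, hpow,
      ← Algebra.smul_def, smul_smul]

lemma h_mul_aeval (g : k[X]) :
    h * aeval p g = aeval p g * h - p * aeval p (derivative g) := by
  induction g using Polynomial.induction_on' with
  | add f g hf hg => rw [map_add, mul_add, hf, hg, map_add, map_add, add_mul, mul_add]; abel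
  | monomial n c =>
    rw [derivative_monomial, aeval_monomial, aeval_monomial, mul_assoc, H.p_pow_mul_h,
      ← mul_assoc, ← Algebra.commutes, mul_assoc, ← mul_assoc p, ← Algebra.commutes, mul_assoc,
      map_mul, mul_assoc, ← mul_sub, map_natCast]
    congr 1
    rcases n with _ | n
    · simp
    · rw [Nat.add_sub_cancel, ← pow_succ', add_mul, add_sub_cancel_right]

lemma normalForm_twist (P : k[X][X]) :
    normalForm k p h (twist k P) = h * normalForm k p h P := by
  induction P using Polynomial.induction_on' with
  | add P Q hP hQ => rw [map_add, map_add, map_add, hP, hQ, mul_add]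
  | monomial j g =>
    rw [twist_monomial, map_sub, normalForm_monomial, normalForm_monomial, normalForm_monomial,
      ← mul_assoc, H.h_mul_aeval, map_mul, aeval_X, sub_mul, pow_succ', mul_assoc, mul_assoc]

lemma normalForm_iterate_twist (P : k[X][X]) (j : ℕ) :
    normalForm k p h ((twist k)^[j] P) = h ^ j * normalForm k p h P := by
  induction j with
  | zero => simp
  | succ j ih => rw [Function.iterate_succ_apply', H.normalForm_twist, ih, pow_succ', mul_assoc]

lemma normalForm_evalAt (P U : k[X][X]) :
    normalForm k p h (evalAt (twist k) P U) = normalForm k p h U * normalForm k p h P := by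
  induction U using Polynomial.induction_on' with
  | add U V hU hV => rw [map_add, map_add, map_add, hU, hV, add_mul]
  | monomial j g =>
    have : evalAt (twist k) P (monomial j g) = g • (twist k)^[j] P := by
      simp [evalAt, lsum]
    rw [this, normalForm_smul, H.normalForm_iterate_twist, normalForm_monomial, mul_assoc]

lemma exists_p_pow_mul_eq (r : R) : ∃ (n : ℕ) (P : k[X][X]), p ^ n * r = normalForm k p h P := by
  suffices ∀ s : R, (∃ (n : ℕ) (P : k[X][X]), p ^ n * s = normalForm k p h P) →
      ∃ (n : ℕ) (P : k[X][X]), p ^ n * (r * s) = normalForm k p h P by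
    simpa using this 1 ⟨0, monomial 0 1, by rw [normalForm_monomial]; simp⟩
  have hshift (m : ℕ) (P : k[X][X]) :
      p ^ m * normalForm k p h P = normalForm k p h ((X ^ m : k[X]) • P) := by
    rw [normalForm_smul, map_pow, aeval_X]
  induction r using H.induction with
  | hp =>
    rintro s ⟨n, P, hP⟩
    refine ⟨n, (X ^ 1 : k[X]) • P, ?_⟩
    rw [← hshift, ← hP, ← mul_assoc, ← mul_assoc, pow_one, ← pow_succ, ← pow_succ']
  | hq =>
    rintro s ⟨n, P, hP⟩
    refine ⟨n + 1, P, ?_⟩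
    rw [← hP, pow_succ, mul_assoc, ← mul_assoc p, H.p_mul_q, one_mul]
  | hh =>
    rintro s ⟨n, P, hP⟩
    refine ⟨n, twist k P + (n : k) • P, ?_⟩
    rw [map_add, H.normalForm_twist, map_smul, ← hP, ← mul_assoc, H.p_pow_mul_h, add_mul, add_mul,
      mul_assoc, mul_assoc, Nat.cast_smul_eq_nsmul, nsmul_eq_mul]
  | algebraMap c =>
    rintro s ⟨n, P, hP⟩
    refine ⟨n, c • P, ?_⟩
    rw [map_smul, ← hP, ← Algebra.smul_def, mul_smul_comm]
  | add a b ha hb =>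
    intro s hs
    obtain ⟨n, P, hP⟩ := ha s hs
    obtain ⟨m, Q, hQ⟩ := hb s hs
    refine ⟨n + m, (X ^ m : k[X]) • P + (X ^ n : k[X]) • Q, ?_⟩
    rw [map_add, ← hshift, ← hshift, ← hP, ← hQ, ← mul_assoc (p ^ m), ← mul_assoc (p ^ n),
      ← pow_add, ← pow_add, add_mul, mul_add, add_comm m n]
  | mul a b ha hb =>
    intro s hs
    simpa only [mul_assoc] using ha _ (hb s hs)

lemma mul_mem_compactIdeal {f : R} (hf : f ∈ compactIdeal p q) (r : R) :
    f * r ∈ compactIdeal p q := by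
  have hgen (j : ℕ) : (1 - q * p) * p ^ j ∈ compactIdeal p q := Ideal.subset_span ⟨j, rfl⟩
  have key {r : R} (hr : ∀ j : ℕ, (1 - q * p) * p ^ j * r ∈ compactIdeal p q) :
      ∀ f ∈ compactIdeal p q, f * r ∈ compactIdeal p q := by
    have : compactIdeal p q ≤
        Submodule.comap (LinearMap.toSpanSingleton R R r) (compactIdeal p q) :=
      Ideal.span_le.2 (by rintro _ ⟨j, rfl⟩; exact hr j)
    exact fun f hf => this hf
  revert f
  induction r using H.induction with
  | hp => exact @(key fun j => by rw [mul_assoc, ← pow_succ]; exact hgen _)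
  | hq =>
    refine @(key fun j => ?_)
    rcases j with _ | j
    · rw [pow_zero, mul_one, H.e_mul_q]; exact zero_mem _
    · rw [pow_succ, mul_assoc, mul_assoc, H.p_mul_q, mul_one]; exact hgen _
  | hh =>
    refine @(key fun j => ?_)
    rw [H.e_mul_p_pow_mul_h]
    exact Submodule.smul_of_tower_mem _ _ (hgen _)
  | algebraMap c =>
    intro f hf
    rw [← Algebra.commutes, ← Algebra.smul_def]
    exact Submodule.smul_of_tower_mem _ _ hf
  | add a b ha hb => exact fun hf => mul_add _ a b ▸ add_mem (ha hf) (hb hf)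
  | mul a b ha hb => exact fun hf => mul_assoc _ a b ▸ hb (ha hf)

lemma sub_mul_mem_compactIdeal (n : ℕ) (r : R) :
    (1 - q ^ n * p ^ n) * r ∈ compactIdeal p q := by
  refine H.mul_mem_compactIdeal ?_ r
  induction n with
  | zero => simp
  | succ n ih =>
    have : 1 - q ^ (n + 1) * p ^ (n + 1)
        = (1 - q ^ n * p ^ n) + q ^ n * ((1 - q * p) * p ^ n) := by
      rw [pow_succ q, pow_succ' p]; noncomm_ring
    rw [this]
    exact add_mem ih (Ideal.mul_mem_left _ _ (Ideal.subset_span ⟨n, rfl⟩))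

lemma exists_mul_e_eq (r : R) : ∃ C : k[X], r * (1 - q * p) = aeval q C * (1 - q * p) := by
  suffices ∀ C : k[X], ∃ C' : k[X],
      r * (aeval q C * (1 - q * p)) = aeval q C' * (1 - q * p) by
    simpa using this 1
  have key {r : R} (hr : ∀ n : ℕ, ∃ C' : k[X],
      r * (q ^ n * (1 - q * p)) = aeval q C' * (1 - q * p)) (C : k[X]) :
      ∃ C' : k[X], r * (aeval q C * (1 - q * p)) = aeval q C' * (1 - q * p) := by
    induction C using Polynomial.induction_on' with
    | add C D hC hD =>
      obtain ⟨C', hC⟩ := hC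
      obtain ⟨D', hD⟩ := hD
      exact ⟨C' + D', by rw [map_add, add_mul, mul_add, hC, hD, map_add, add_mul]⟩
    | monomial n c =>
      obtain ⟨C', hC⟩ := hr n
      refine ⟨c • C', ?_⟩
      rw [aeval_monomial, ← Algebra.smul_def, smul_mul_assoc, mul_smul_comm, hC, map_smul,
        smul_mul_assoc]
  induction r using H.induction with
  | hp =>
    refine key fun n => ?_
    rcases n with _ | n
    · exact ⟨0, by rw [pow_zero, one_mul, H.p_mul_e, map_zero, zero_mul]⟩
    · refine ⟨X ^ n, ?_⟩
      rw [pow_succ', ← mul_assoc, ← mul_assoc, H.p_mul_q, one_mul, map_pow, aeval_X]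
  | hq =>
    refine key fun n => ⟨X ^ (n + 1), ?_⟩
    rw [map_pow, aeval_X, pow_succ', mul_assoc]
  | hh =>
    refine key fun n => ⟨((n : k) + 1) • X ^ n, ?_⟩
    rw [← mul_assoc, H.h_mul_q_pow, mul_assoc, add_mul, H.h_mul_e, map_smul, map_pow, aeval_X,
      smul_mul_assoc, ← mul_smul_comm, add_smul, one_smul, Nat.cast_smul_eq_nsmul, nsmul_eq_mul,
      add_comm]
  | algebraMap c =>
    intro C
    exact ⟨c • C, by rw [← Algebra.smul_def, map_smul, smul_mul_assoc]⟩
  | add a b ha hb =>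
    intro C
    obtain ⟨A, hA⟩ := ha C
    obtain ⟨B, hB⟩ := hb C
    exact ⟨A + B, by rw [add_mul, hA, hB, map_add, add_mul]⟩
  | mul a b ha hb =>
    intro C
    obtain ⟨B, hB⟩ := hb C
    obtain ⟨A, hA⟩ := ha B
    exact ⟨A, by rw [mul_assoc, hB, hA]⟩

lemma p_pow_natDegree_mul_aeval (C : k[X]) :
    p ^ C.natDegree * (aeval q C * (1 - q * p)) = C.leadingCoeff • (1 - q * p) := by
  rw [aeval_eq_sum_range, Finset.sum_range_succ, add_mul, mul_add, Finset.sum_mul,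
    Finset.mul_sum, Finset.sum_eq_zero, zero_add, smul_mul_assoc, mul_smul_comm, ← mul_assoc]
  · have := H.p_pow_mul_q_pow C.natDegree 0
    rw [add_zero, pow_zero] at this
    rw [this, one_mul, leadingCoeff]
  · intro i hi
    obtain ⟨m, hm⟩ := Nat.exists_eq_add_of_lt (Finset.mem_range.1 hi)
    rw [smul_mul_assoc, mul_smul_comm, ← mul_assoc, hm, add_assoc, H.p_pow_mul_q_pow, pow_succ,
      mul_assoc, H.p_mul_e, mul_zero, smul_zero]

lemma isNoetherian_span (j : ℕ) :
    IsNoetherian R (Ideal.span {(1 - q * p) * p ^ j} : Ideal R) := by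
  rw [isNoetherian_submodule]
  intro L hL
  by_cases hbot : L = ⊥
  · exact hbot ▸ Submodule.fg_bot
  obtain ⟨x, hx, hx0⟩ := Submodule.exists_mem_ne_zero_of_ne_bot hbot
  obtain ⟨r, rfl⟩ := Submodule.mem_span_singleton.1 (hL hx)
  obtain ⟨C, hC⟩ := H.exists_mul_e_eq r
  rw [smul_eq_mul, ← mul_assoc, hC] at hx hx0
  have hC0 : C ≠ 0 := by
    rintro rfl
    simp at hx0
  have hmem : (1 - q * p) * p ^ j ∈ L := by
    have h1 := Ideal.mul_mem_left L (p ^ C.natDegree) hx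
    rw [← mul_assoc, H.p_pow_natDegree_mul_aeval, smul_mul_assoc] at h1
    have h2 := Submodule.smul_of_tower_mem L C.leadingCoeff⁻¹ h1
    rwa [inv_smul_smul₀ (leadingCoeff_ne_zero.2 hC0)] at h2
  rw [le_antisymm hL ((Ideal.span_singleton_le_iff_mem _).2 hmem)]
  exact Submodule.fg_span_singleton _

lemma isNoetherian_compactIdealLT (n : ℕ) : IsNoetherian R (compactIdealLT p q n) := by
  have (j : Fin n) := H.isNoetherian_span (j : ℕ)
  exact isNoetherian_iSup

lemma fg_of_le_compactIdealLT {L : Ideal R} {n : ℕ} (hL : L ≤ compactIdealLT p q n) : L.FG :=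
  isNoetherian_submodule.1 (H.isNoetherian_compactIdealLT n) L hL

lemma exists_le_sup_compactIdealLT [CharZero k] {L : Ideal R} {P : k[X][X]} (hP : P ≠ 0)
    (hPL : normalForm k p h P ∈ L) : ∃ n, compactIdeal p q ≤ L ⊔ compactIdealLT p q n := by
  set Q := Bivariate.swap (R := k) P with hQdef
  have hQ : Q ≠ 0 := (map_ne_zero_iff _ (AlgEquiv.injective _)).2 hP
  set d := Q.natDegree
  have hlc : Q.coeff d ≠ 0 := leadingCoeff_ne_zero.2 hQ
  have hfin : {n : ℕ | (Q.coeff d).eval ((n : k) + 1) = 0}.Finite := by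
    refine Set.Finite.preimage (f := fun n : ℕ => (n : k) + 1) (fun a _ b _ hab => ?_)
      (finite_setOfPred_isRoot hlc)
    exact Nat.cast_injective (add_right_cancel hab)
  obtain ⟨N, hN⟩ := hfin.bddAbove
  refine ⟨d + N + 1, Ideal.span_le.2 ?_⟩
  rintro _ ⟨j, rfl⟩
  change (1 - q * p) * p ^ j ∈ L ⊔ compactIdealLT p q (d + N + 1)
  induction j using Nat.strong_induction_on with
  | _ j ih =>
    by_cases hj : j < d + N + 1
    · exact le_sup_right (a := L) (mem_compactIdealLT hj)
    obtain ⟨m, rfl⟩ : ∃ m, j = m + d := ⟨j - d, by omega⟩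
    have hroot : (Q.coeff d).eval (((m + d : ℕ) : k) + 1) ≠ 0 := fun h0 => by
      have : m + d ≤ N := hN h0
      omega
    have hmem := Ideal.mul_mem_left (L ⊔ compactIdealLT p q (d + N + 1)) ((1 - q * p) * p ^ m)
      (le_sup_left (b := compactIdealLT p q (d + N + 1)) hPL)
    have hexp : (1 - q * p) * p ^ m * normalForm k p h P =
        ∑ i ∈ Finset.range (d + 1),
          (Q.coeff i).eval (((m + i : ℕ) : k) + 1) • ((1 - q * p) * p ^ (m + i)) := by
      rw [normalForm_eq_sum, ← hQdef, sum_over_range _ (by simp), Finset.mul_sum]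
      refine Finset.sum_congr rfl fun i _ => ?_
      rw [← mul_assoc, mul_assoc _ (p ^ m), ← pow_add, H.e_mul_p_pow_mul_aeval]
    rw [hexp, Finset.sum_range_succ, Submodule.add_mem_iff_right] at hmem
    · have h2 := Submodule.smul_of_tower_mem _ ((Q.coeff d).eval (((m + d : ℕ) : k) + 1))⁻¹ hmem
      rwa [inv_smul_smul₀ hroot] at h2
    · refine sum_mem fun i hi => Submodule.smul_of_tower_mem _ _ (ih _ ?_)
      have := Finset.mem_range.1 hi
      omega

lemma fg_of_normalForm_mem [CharZero k] {L : Ideal R} {P : k[X][X]} (hP : P ≠ 0)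
    (hPL : normalForm k p h P ∈ L) : L.FG := by
  let pull (I : Ideal R) : Submodule k[X] k[X][X] :=
    { carrier := {P | normalForm k p h P ∈ I}
      add_mem' := fun {U V} hU hV => by
        simpa only [Set.mem_ofPred_eq, map_add] using add_mem hU hV
      zero_mem' := by simp
      smul_mem' := fun g U hU => by
        simpa only [Set.mem_ofPred_eq, normalForm_smul] using I.mul_mem_left _ hU }
  have hpull (I : Ideal R) : ∀ P ∈ pull I, twist k P ∈ pull I := fun P hP => by
    change normalForm k p h (twist k P) ∈ I
    rw [H.normalForm_twist]
    exact I.mul_mem_left _ hP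
  obtain ⟨s, hsL, hs⟩ := (degreeRaising_twist k).exists_finset (pull L) (hpull L)
  classical
  let L₀ : Ideal R := Ideal.span (s.image (normalForm k p h) : Finset R)
  have hL₀L : L₀ ≤ L := Ideal.span_le.2 fun x hx => by
    obtain ⟨U, hU, rfl⟩ := Finset.mem_image.1 (Finset.mem_coe.1 hx)
    exact hsL hU
  have hLL₀ : pull L ≤ pull L₀ := hs _ (hpull L₀) fun U hU =>
    Ideal.subset_span (Finset.mem_coe.2 (Finset.mem_image_of_mem _ hU))
  have hPL₀ : normalForm k p h P ∈ L₀ := hLL₀ (show P ∈ pull L from hPL)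
  obtain ⟨n, hn⟩ := H.exists_le_sup_compactIdealLT hP hPL₀
  have hL : L ≤ L₀ ⊔ compactIdealLT p q n := fun r hr => by
    obtain ⟨m, U, hU⟩ := H.exists_p_pow_mul_eq r
    have h1 : p ^ m * r ∈ L₀ := hU ▸ hLL₀ (show U ∈ pull L from
      (hU ▸ L.mul_mem_left _ hr : normalForm k p h U ∈ L))
    have h2 : r = q ^ m * (p ^ m * r) + (1 - q ^ m * p ^ m) * r := by noncomm_ring
    rw [h2]
    exact add_mem (le_sup_left (b := compactIdealLT p q n) (L₀.mul_mem_left _ h1))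
      (hn (H.sub_mul_mem_compactIdeal m r))
  have hLeq : L = L₀ ⊔ compactIdealLT p q n ⊓ L := by
    rw [← sup_inf_assoc_of_le _ hL₀L, inf_eq_right.2 hL]
  rw [hLeq]
  exact Submodule.FG.sup ⟨_, rfl⟩ (H.fg_of_le_compactIdealLT inf_le_left)

lemma le_compactIdeal {L : Ideal R} (hL : ∀ P : k[X][X], normalForm k p h P ∈ L → P = 0) :
    L ≤ compactIdeal p q := fun r hr => by
  obtain ⟨n, P, hP⟩ := H.exists_p_pow_mul_eq r
  have hP0 := hL P (hP ▸ L.mul_mem_left _ hr)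
  have hr' := H.sub_mul_mem_compactIdeal n r
  rwa [sub_mul, one_mul, mul_assoc, hP, hP0, map_zero, mul_zero, sub_zero] at hr'

/-- An intersection of two finitely generated left ideals is finitely generated. -/
theorem fg_inf [CharZero k] {I J : Ideal R} (hI : I.FG) (hJ : J.FG) : (I ⊓ J).FG := by
  by_cases hI0 : ∀ P : k[X][X], normalForm k p h P ∈ I → P = 0
  · obtain ⟨n, hn⟩ := exists_le_compactIdealLT hI (H.le_compactIdeal hI0)
    exact H.fg_of_le_compactIdealLT (inf_le_left.trans hn)
  by_cases hJ0 : ∀ P : k[X][X], normalForm k p h P ∈ J → P = 0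
  · obtain ⟨n, hn⟩ := exists_le_compactIdealLT hJ (H.le_compactIdeal hJ0)
    exact H.fg_of_le_compactIdealLT (inf_le_right.trans hn)
  push Not at hI0 hJ0
  obtain ⟨P, hPI, hP⟩ := hI0
  obtain ⟨Q, hQJ, hQ⟩ := hJ0
  obtain ⟨U, V, hUV, hne⟩ := (degreeRaising_twist k).exists_evalAt_eq hP hQ
  refine H.fg_of_normalForm_mem hne ⟨?_, ?_⟩
  · rw [SetLike.mem_coe, H.normalForm_evalAt]
    exact I.mul_mem_left _ hPI
  · rw [SetLike.mem_coe, hUV, H.normalForm_evalAt]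
    exact J.mul_mem_left _ hQJ

protected lemma op : IntegroDifferential k (MulOpposite.op q) (MulOpposite.op p)
    (MulOpposite.op h) where
  p_mul_q := by rw [← MulOpposite.op_mul, H.p_mul_q, MulOpposite.op_one]
  p_mul_h := by
    rw [← MulOpposite.op_mul, H.h_mul_q, MulOpposite.op_mul, MulOpposite.op_add,
      MulOpposite.op_one]
  h_mul_q := by
    rw [← MulOpposite.op_mul, H.p_mul_h, MulOpposite.op_mul, MulOpposite.op_add,
      MulOpposite.op_one]
  h_mul_e := by
    rw [← MulOpposite.op_mul, ← MulOpposite.op_one, ← MulOpposite.op_sub, ← MulOpposite.op_mul,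
      H.e_mul_h]
  e_mul_h := by
    rw [← MulOpposite.op_mul, ← MulOpposite.op_one, ← MulOpposite.op_sub, ← MulOpposite.op_mul,
      H.h_mul_e]
  adjoin_eq_top := by
    have key : ∀ r : R, MulOpposite.op r ∈
        Algebra.adjoin k {MulOpposite.op q, MulOpposite.op p, MulOpposite.op h} := fun r => by
      induction r using H.induction with
      | hp => exact Algebra.subset_adjoin (by simp)
      | hq => exact Algebra.subset_adjoin (by simp)
      | hh => exact Algebra.subset_adjoin (by simp)
      | algebraMap c => exact algebraMap_mem _ c
      | add a b ha hb => exact add_mem ha hb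
      | mul a b ha hb => exact mul_mem hb ha
    exact eq_top_iff.2 fun r _ => key r.unop

end IntegroDifferential

end NormalForm

section RightIdeals

variable {R : Type*} [Ring R]

/-- The identity `R → Rᵐᵒᵖ` as an isomorphism of right `R`-modules. -/
def opRightEquiv (R : Type*) [Ring R] : R ≃ₗ[Rᵐᵒᵖ] Rᵐᵒᵖ where
  __ := MulOpposite.opAddEquiv
  map_smul' _ _ := rfl

lemma fg_inf_of_op (hR : ∀ I J : Ideal Rᵐᵒᵖ, I.FG → J.FG → (I ⊓ J).FG)
    {I J : Submodule Rᵐᵒᵖ R} (hI : I.FG) (hJ : J.FG) : (I ⊓ J).FG := by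
  have h := hR _ _ (hI.map (opRightEquiv R).toLinearMap) (hJ.map (opRightEquiv R).toLinearMap)
  rw [← Submodule.map_inf _ (opRightEquiv R).injective] at h
  exact Submodule.fg_of_fg_map_injective _ (opRightEquiv R).injective h

end RightIdeals

lemma intOp_X_pow (n : ℕ) : intOp K (X ^ n) = ((n : K) + 1)⁻¹ • X ^ (n + 1) := by
  simpa only [intOp, coe_basisMonomials, monomial_one_right_eq_X_pow] using
    (basisMonomials K).constr_basis K (fun n : ℕ => ((n : K) + 1)⁻¹ • (X : K[X]) ^ (n + 1)) n

lemma natCast_add_one_ne_zero (n : ℕ) : (n : K) + 1 ≠ 0 := Nat.cast_add_one_ne_zero n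

lemma derOp_X_pow_succ (n : ℕ) : derOp K (X ^ (n + 1)) = ((n : K) + 1) • X ^ n := by
  simp [derOp, smul_eq_C_mul]

lemma derOp_one : derOp K 1 = 0 := derivative_one

lemma xOp_X_pow (n : ℕ) : xOp K (X ^ n) = X ^ (n + 1) := by
  simp [xOp, pow_succ']

lemma hOp_X_pow (n : ℕ) : hOp K (X ^ n) = ((n : K) + 1) • X ^ n := by
  rw [hOp, Module.End.mul_apply, xOp_X_pow, derOp_X_pow_succ]

lemma end_ext_X_pow {f g : Module.End K K[X]} (hfg : ∀ n : ℕ, f (X ^ n) = g (X ^ n)) : f = g :=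
  (basisMonomials K).ext fun n => by
    simpa only [intOp, coe_basisMonomials, monomial_one_right_eq_X_pow] using hfg n

lemma intOp_mul_hOp : intOp K * hOp K = xOp K := end_ext_X_pow K fun n => by
  rw [Module.End.mul_apply, hOp_X_pow, map_smul, intOp_X_pow,
    smul_inv_smul₀ (natCast_add_one_ne_zero K n), xOp_X_pow]

lemma one_sub_intOp_mul_derOp_X_pow_succ (n : ℕ) :
    (1 - intOp K * derOp K) (X ^ (n + 1)) = 0 := by
  rw [LinearMap.sub_apply, Module.End.mul_apply, derOp_X_pow_succ, map_smul, intOp_X_pow,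
    smul_inv_smul₀ (natCast_add_one_ne_zero K n), Module.End.one_apply, sub_self]

lemma one_sub_intOp_mul_derOp_one : (1 - intOp K * derOp K) 1 = 1 := by
  rw [LinearMap.sub_apply, Module.End.mul_apply, derOp_one, map_zero, sub_zero,
    Module.End.one_apply]

lemma hOp_one : hOp K 1 = 1 := by
  simpa using hOp_X_pow K 0

lemma derOp_mul_hOp : derOp K * hOp K = (hOp K + 1) * derOp K := end_ext_X_pow K fun n => by
  rcases n with _ | n
  · simp [derOp_one, hOp_one]
  · rw [Module.End.mul_apply, hOp_X_pow, map_smul, derOp_X_pow_succ, Module.End.mul_apply,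
      derOp_X_pow_succ, map_smul, LinearMap.add_apply, hOp_X_pow, Module.End.one_apply,
      Nat.cast_succ]
    module

lemma hOp_mul_intOp : hOp K * intOp K = intOp K * (hOp K + 1) := end_ext_X_pow K fun n => by
  rw [Module.End.mul_apply, intOp_X_pow, map_smul, hOp_X_pow, Module.End.mul_apply,
    LinearMap.add_apply, hOp_X_pow, Module.End.one_apply, map_add, map_smul, intOp_X_pow,
    smul_comm, Nat.cast_succ, add_smul _ (1 : K), one_smul]

lemma hOp_mul_one_sub : hOp K * (1 - intOp K * derOp K) = 1 - intOp K * derOp K :=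
  end_ext_X_pow K fun n => by
    rcases n with _ | n
    · rw [pow_zero, Module.End.mul_apply, one_sub_intOp_mul_derOp_one, hOp_one]
    · rw [Module.End.mul_apply, one_sub_intOp_mul_derOp_X_pow_succ, map_zero]

lemma one_sub_mul_hOp : (1 - intOp K * derOp K) * hOp K = 1 - intOp K * derOp K :=
  end_ext_X_pow K fun n => by
    rcases n with _ | n
    · rw [pow_zero, Module.End.mul_apply, hOp_one]
    · rw [Module.End.mul_apply, hOp_X_pow, map_smul, one_sub_intOp_mul_derOp_X_pow_succ,
        smul_zero]

/-- `H = ∂ x` as an element of the ring `I₁`. -/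
def hI : I1 K := ⟨hOp K, mul_mem (derOp_mem K) (xOp_mem K)⟩

lemma adjoin_derI_intI_hI : Algebra.adjoin K {derI K, intI K, hI K} = ⊤ := by
  have htop : Algebra.adjoin K ((↑) ⁻¹' {xOp K, derOp K, intOp K} : Set (I1 K)) = ⊤ :=
    Algebra.adjoin_adjoin_coe_preimage
  rw [eq_top_iff, ← htop, Algebra.adjoin_le_iff]
  rintro ⟨a, ha⟩ hmem
  have hd : derI K ∈ Algebra.adjoin K {derI K, intI K, hI K} := Algebra.subset_adjoin (by simp)
  have hi : intI K ∈ Algebra.adjoin K {derI K, intI K, hI K} := Algebra.subset_adjoin (by simp)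
  have hh : hI K ∈ Algebra.adjoin K {derI K, intI K, hI K} := Algebra.subset_adjoin (by simp)
  rcases hmem with rfl | rfl | rfl
  · have hx : intI K * hI K = ⟨xOp K, ha⟩ := Subtype.ext (intOp_mul_hOp K)
    exact hx ▸ mul_mem hi hh
  · exact hd
  · exact hi

lemma integroDifferential_I1 : IntegroDifferential K (derI K) (intI K) (hI K) where
  p_mul_q := Subtype.ext (derOp_mul_intOp K)
  p_mul_h := Subtype.ext (derOp_mul_hOp K)
  h_mul_q := Subtype.ext (hOp_mul_intOp K)
  h_mul_e := Subtype.ext (hOp_mul_one_sub K)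
  e_mul_h := Subtype.ext (one_sub_mul_hOp K)
  adjoin_eq_top := adjoin_derI_intI_hI K

/-- the intersection of two finitely generated left (resp. right) ideals of
`I₁` is a finitely generated left (resp. right) ideal. -/
theorem statement7 :
    (∀ I J : Ideal (I1 K), I.FG → J.FG → (I ⊓ J).FG)
    ∧ (∀ I J : Submodule ((I1 K)ᵐᵒᵖ) (I1 K), I.FG → J.FG → (I ⊓ J).FG) := by
  exact ⟨fun _ _ => (integroDifferential_I1 K).fg_inf,
    fun _ _ => fg_inf_of_op fun _ _ => (integroDifferential_I1 K).op.fg_inf⟩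

end
end
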